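/- arXiv:2101.00779 — 7 statements merged into one kernel-verified Lean document; each statement's English description precedes it below -/
import Mathlib

section
/- For all integers ℓ ≥ 2 and t ≥ 2, the (t−1)-chromatic Ramsey number of the path on ℓ vertices satisfies R^t_{t−1}(P_ℓ) = ℓ + ⌊(ℓ−2)/(2^t−2)⌋. That is, ℓ + ⌊(ℓ−2)/(2^t−2)⌋ is the least integer N such that every t-colouring of the edges of the complete graph K_N contains a path on ℓ vertices all of whose edges use at most t−1 of the t colours. -/
/-- There is a path on `ℓ` vertices in the complete graph on `Fin n`, all of whose edges
avoid colour `i` under the edge-colouring `c`. -/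
def AvoidsPath (n t ℓ : ℕ) (c : Sym2 (Fin n) → Fin t) (i : Fin t) : Prop :=
  ∃ P : Fin ℓ → Fin n, Function.Injective P ∧
    ∀ k : ℕ, ∀ h : k + 1 < ℓ, c s(P ⟨k, Nat.lt_of_succ_lt h⟩, P ⟨k + 1, h⟩) ≠ i

/-- Every `t`-colouring of the edges of `K_n` contains, for some colour `i`,
a path on `L i` vertices avoiding colour `i`. -/
def IsChromRamsey (t : ℕ) (L : Fin t → ℕ) (n : ℕ) : Prop :=
  ∀ c : Sym2 (Fin n) → Fin t, ∃ i : Fin t, AvoidsPath n t (L i) c i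

/-- `p(L)`: the least `n` such that every `t`-colouring of `K_n` contains, for some colour `i`,
a path on `L i` vertices avoiding colour `i`. -/
noncomputable def pRamsey (t : ℕ) (L : Fin t → ℕ) : ℕ := sInf {n | IsChromRamsey t L n}

/-- `s(L) = ⌊(L₁ + 2·L₂ + ⋯ + 2^(t-1)·L_t - 2) / (2^t - 2)⌋`. -/
def sVal (t : ℕ) (L : Fin t → ℕ) : ℕ :=
  ((∑ i : Fin t, 2 ^ (i : ℕ) * L i) - 2) / (2 ^ t - 2)

lemma countP_add_countP_tail_le {α : Type*} (p r : α → Bool) : ∀ (x : α) (l : List α),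
    (x :: l).IsChain (fun y z => ¬(p y = true ∧ r z = true)) →
    (∀ y ∈ (x :: l).getLast?, p y = false) →
    (x :: l).countP p + l.countP r ≤ l.length := by
  intro x l
  induction l generalizing x with
  | nil => intro _ h; simp at h; simp [h]
  | cons y l ih =>
    intro hc hl
    rw [List.isChain_cons_cons] at hc
    have := ih y hc.2 (by simpa using hl)
    have h1 := hc.1
    simp only [List.countP_cons, List.length_cons] at this ⊢
    cases hp : p x <;> cases hr : r y <;> simp_all <;> omega

lemma countP_add_countP_lt {α : Type*} (p r : α → Bool) (l : List α) (hl : l ≠ [])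
    (hc : l.IsChain (fun y z => ¬(p y = true ∧ r z = true)))
    (hlast : ∀ y ∈ l.getLast?, p y = false) (hhead : ∀ y ∈ l.head?, r y = false) :
    l.countP p + l.countP r + 1 ≤ l.length := by
  cases l with
  | nil => exact absurd rfl hl
  | cons x l =>
    have := countP_add_countP_tail_le p r x l hc hlast
    have hx : r x = false := hhead x (by simp)
    rw [List.countP_cons (p := r)]
    simp [hx]; omega

/-- `G` contains a path on at least `k` vertices. -/
def HasPath {V : Type*} (G : SimpleGraph V) (k : ℕ) : Prop :=
  ∃ l : List V, l.Nodup ∧ l.IsChain G.Adj ∧ k ≤ l.length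

section
open SimpleGraph
open scoped Classical
variable {V : Type*} [Fintype V]

/-- The degree of `v` in `G`. -/
noncomputable def deg (G : SimpleGraph V) (v : V) : ℕ :=
  (Finset.univ.filter fun w => G.Adj v w).card

lemma isChain_adj_reverse {V : Type*} {G : SimpleGraph V} {l : List V} (h : l.IsChain G.Adj) :
    l.reverse.IsChain G.Adj := by
  rw [List.isChain_reverse]
  exact h.imp fun _ _ hab => hab.symm

lemma HasPath.of_perm {V : Type*} {G : SimpleGraph V} {l l' : List V} (hl : l.Nodup)
    (hp : l'.Perm l) (hc : l'.IsChain G.Adj) {k : ℕ} (hk : k ≤ l.length) : HasPath G k :=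
  ⟨l', hp.nodup_iff.2 hl, hc, hp.length_eq ▸ hk⟩

lemma deg_eq_countP_add (G : SimpleGraph V) (v : V) (l : List V) (hl : l.Nodup) :
    deg G v = l.countP (fun w => decide (G.Adj v w)) +
      (Finset.univ.filter fun w => w ∉ l ∧ G.Adj v w).card := by
  have h1 : l.countP (fun w => decide (G.Adj v w)) =
      (Finset.univ.filter fun w => w ∈ l ∧ G.Adj v w).card := by
    rw [List.countP_eq_length_filter, ← List.toFinset_card_of_nodup (hl.filter _)]
    congr 1
    ext w
    simp
  rw [h1, deg, ← Finset.card_union_of_disjoint]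
  · congr 1
    ext w
    simp only [Finset.mem_filter, Finset.mem_union, Finset.mem_univ, true_and]
    tauto
  · rw [Finset.disjoint_filter]
    tauto

lemma deg_add_deg_le_of_join {G : SimpleGraph V} {u v : V} (A B : List V)
    (hu : u ∈ A.getLast?) (hv : v ∈ B.head?) (hnd : (A ++ B).Nodup) (hA : A.IsChain G.Adj)
    (hB : B.IsChain G.Adj) {k : ℕ} (hk : k ≤ (A ++ B).length) (hno : ¬ HasPath G k) :
    deg G u + deg G v + 2 ≤ Fintype.card V := by
  have hlast : ∀ x ∈ A.getLast?, x = u := fun x hx => Option.mem_unique hx hu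
  have hhead : ∀ x ∈ B.head?, x = v := fun x hx => Option.mem_unique hx hv
  have hA0 : A ≠ [] := by rintro rfl; simp at hu
  have hB0 : B ≠ [] := by rintro rfl; simp at hv
  have inA : A.countP (fun w => decide (G.Adj u w)) + A.countP (fun w => decide (G.Adj v w)) + 1
      ≤ A.length := by
    apply countP_add_countP_lt _ _ _ hA0
    · rw [List.isChain_iff_forall_rel_of_append_cons_cons]
      rintro x y l₁ l₂ rfl ⟨hx, hy⟩
      simp only [decide_eq_true_eq] at hx hy
      rw [List.isChain_append_cons_cons] at hA
      refine hno (HasPath.of_perm (l' := (l₁ ++ [x]) ++ ((y :: l₂).reverse ++ B)) hnd ?_ ?_ hk)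
      · rw [List.append_cons l₁ x (y :: l₂), ← List.append_assoc]
        exact ((List.reverse_perm _).append_left _).append_right B
      · refine hA.1.append ((isChain_adj_reverse hA.2.2).append hB ?_) ?_
        · intro a ha b hb
          simp at ha
          rw [hhead b hb, ← ha]
          exact hy.symm
        · intro a ha b hb
          simp at ha
          subst ha
          rw [List.head?_append, List.head?_reverse] at hb
          rw [hlast b (by rw [List.getLast?_append]; cases h : (y :: l₂).getLast? <;> simp_all)]
          exact hx.symm
    · intro y hy
      rw [hlast y hy]
      simp
    · intro y hy
      simp only [decide_eq_false_iff_not]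
      intro hvy
      refine hno (HasPath.of_perm (l' := A.reverse ++ B) hnd ?_ ?_ hk)
      · exact (List.reverse_perm A).append_right B
      · refine (isChain_adj_reverse hA).append hB ?_
        intro a ha b hb
        rw [hhead b hb]
        rw [List.getLast?_reverse] at ha
        rw [Option.mem_unique ha hy]
        exact hvy.symm
  have inB : B.countP (fun w => decide (G.Adj u w)) + B.countP (fun w => decide (G.Adj v w)) + 1
      ≤ B.length := by
    apply countP_add_countP_lt _ _ _ hB0
    · rw [List.isChain_iff_forall_rel_of_append_cons_cons]
      rintro x y l₁ l₂ rfl ⟨hx, hy⟩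
      simp only [decide_eq_true_eq] at hx hy
      rw [List.isChain_append_cons_cons] at hB
      refine hno (HasPath.of_perm (l' := A ++ ((l₁ ++ [x]).reverse ++ (y :: l₂))) hnd ?_ ?_ hk)
      · rw [List.append_cons l₁ x (y :: l₂)]
        exact ((List.reverse_perm _).append_right _).append_left A
      · refine hA.append ((isChain_adj_reverse hB.1).append hB.2.2 ?_) ?_
        · intro a ha b hb
          simp at hb
          subst hb
          rw [List.getLast?_reverse] at ha
          rw [hhead a (by rw [List.append_cons l₁ x, List.head?_append]; simp [Option.mem_def.1 ha])]
          exact hy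
        · intro a ha b hb
          rw [hlast a ha]
          simp at hb
          rw [← hb]
          exact hx
    · intro y hy
      simp only [decide_eq_false_iff_not]
      intro huy
      refine hno (HasPath.of_perm (l' := A ++ B.reverse) hnd ?_ ?_ hk)
      · exact (List.reverse_perm B).append_left A
      · refine hA.append (isChain_adj_reverse hB) ?_
        intro a ha b hb
        rw [hlast a ha]
        rw [List.head?_reverse] at hb
        rw [Option.mem_unique hb hy]
        exact huy
    · intro y hy
      rw [hhead y hy]
      simp
  have hout : (Finset.univ.filter fun w => w ∉ A ++ B ∧ G.Adj u w).card +
      (Finset.univ.filter fun w => w ∉ A ++ B ∧ G.Adj v w).card ≤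
      Fintype.card V - (A ++ B).length := by
    rw [← Finset.card_union_of_disjoint, ← List.toFinset_card_of_nodup hnd, ← Finset.card_compl]
    · apply Finset.card_le_card
      intro w
      simp
      tauto
    · rw [Finset.disjoint_filter]
      rintro w - ⟨hw, huw⟩ ⟨-, hvw⟩
      refine hno ⟨A ++ w :: B, ?_, ?_, ?_⟩
      · rw [List.nodup_middle, List.nodup_cons]
        exact ⟨hw, hnd⟩
      · refine hA.append (List.isChain_cons.2 ⟨?_, hB⟩) ?_
        · intro b hb
          rw [hhead b hb]
          exact hvw.symm
        · intro a ha b hb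
          simp at hb
          rw [hlast a ha, ← hb]
          exact huw
      · simp at hk ⊢
        omega
  have hlen : (A ++ B).length ≤ Fintype.card V := hnd.length_le_card
  rw [deg_eq_countP_add G u _ hnd, deg_eq_countP_add G v _ hnd, List.countP_append,
    List.countP_append]
  rw [List.length_append] at *
  omega

theorem deg_add_deg_le_of_hasPath_sup_edge {G : SimpleGraph V} {u v : V} {k : ℕ}
    (hP : HasPath (G ⊔ edge u v) k) (hno : ¬ HasPath G k) :
    deg G u + deg G v + 2 ≤ Fintype.card V := by
  obtain ⟨l, hnd, hc, hk⟩ := hP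
  by_cases hcG : l.IsChain G.Adj
  · exact absurd ⟨l, hnd, hcG, hk⟩ hno
  rw [List.isChain_iff_forall_rel_of_append_cons_cons] at hcG
  push Not at hcG
  obtain ⟨x, y, l₁, l₂, rfl, hxy⟩ := hcG
  rw [List.isChain_append_cons_cons] at hc
  rw [List.append_cons] at hnd hk
  have hdis := (List.nodup_append.1 hnd).2.2
  have he : x = u ∧ y = v ∨ x = v ∧ y = u := by
    have := hc.2.1
    rw [sup_adj, edge_adj] at this
    tauto
  have key : ∀ l : List V, (x ∉ l ∨ y ∉ l) →
      l.IsChain (G ⊔ edge u v).Adj → l.IsChain G.Adj := by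
    intro l hl h
    refine h.imp_of_mem_imp ?_
    intro p r hp hr hpr
    rw [sup_adj, edge_adj] at hpr
    rcases hpr with hpr | hpr
    · exact hpr
    · exfalso
      grind
  have hA := key _ (Or.inr (fun h => hdis _ h y (by simp) rfl)) hc.1
  have hB := key _ (Or.inl (fun h => hdis x (by simp) _ h rfl)) hc.2.2
  have := deg_add_deg_le_of_join (u := x) (v := y) _ _ (by simp) (by simp) hnd hA hB hk hno
  rcases he with ⟨rfl, rfl⟩ | ⟨rfl, rfl⟩ <;> omega

/-- A graph without a path on `k` vertices lies in one that has no such path either and in which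
the degrees of any two nonadjacent vertices sum to at most `|V| - 2`. -/
theorem exists_closed_supergraph {G : SimpleGraph V} {k : ℕ} (hno : ¬ HasPath G k) :
    ∃ G' : SimpleGraph V, G ≤ G' ∧ ¬ HasPath G' k ∧
      ∀ u v, u ≠ v → ¬ G'.Adj u v → deg G' u + deg G' v + 2 ≤ Fintype.card V := by
  obtain ⟨G', hle, hmax⟩ := Finite.exists_le_maximal
    (p := fun H : SimpleGraph V => ¬ HasPath H k) hno
  refine ⟨G', hle, hmax.prop, fun u v huv hn => ?_⟩
  refine deg_add_deg_le_of_hasPath_sup_edge ?_ hmax.prop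
  by_contra h
  exact hmax.not_prop_of_gt (lt_sup_edge _ _ _ huv hn) h

lemma exists_alternating_list {V : Type*} {G : SimpleGraph V} (vs ws : List V) (k : ℕ)
    (hkv : k ≤ vs.length) (hkw : k ≤ ws.length)
    (hadj : ∀ i j (hi : i < vs.length) (hj : j < ws.length), j < k → j ≤ i → G.Adj vs[i] ws[j]) :
    ∃ l : List V, l.Perm (vs.take k ++ ws.take k) ∧ l.IsChain G.Adj ∧
      ∀ x ∈ l.getLast?, x ∈ ws.take k := by
  induction k with
  | zero => exact ⟨[], by simp, by simp, by simp⟩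
  | succ k ih =>
    obtain ⟨l, hp, hc, hlast⟩ := ih (by omega) (by omega)
      (fun i j hi hj h => hadj i j hi hj (by omega))
    have hv : k < vs.length := by omega
    have hw : k < ws.length := by omega
    refine ⟨l ++ [vs[k], ws[k]], ?_, ?_, ?_⟩
    · rw [← List.take_concat_get' _ _ hv, ← List.take_concat_get' _ _ hw]
      refine (hp.append_right _).trans ?_
      rw [List.append_assoc, List.append_assoc]
      refine List.Perm.append_left _ ?_
      change (ws.take k ++ ([vs[k]] ++ [ws[k]])).Perm _
      rw [← List.append_assoc, ← List.append_assoc]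
      exact (List.perm_append_comm).append_right _
    · refine hc.append ?_ ?_
      · simpa using hadj k k hv hw (by omega) le_rfl
      · intro x hx y hy
        obtain ⟨j, hj, rfl⟩ := List.mem_take_iff_getElem.1 (hlast x hx)
        simp at hy
        rw [← hy]
        exact (hadj k j hv (by omega) (by omega) (by omega)).symm
    · intro x hx
      simp at hx
      rw [← hx, List.mem_take_iff_getElem]
      exact ⟨k, by omega, rfl⟩

lemma exists_sorted_list {V : Type*} (S : Finset V) (g : V → ℕ) :
    ∃ L : List V, L.Nodup ∧ (∀ x, x ∈ L ↔ x ∈ S) ∧ L.length = S.card ∧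
      ∀ i j (hi : i < L.length) (hj : j < L.length), i ≤ j → g L[i] ≤ g L[j] := by
  let r : V → V → Prop := fun x y => g x ≤ g y
  have : Std.Total r := ⟨fun x y => le_total (g x) (g y)⟩
  have : IsTrans V r := ⟨fun x y z => le_trans (a := g x)⟩
  have hp := List.perm_insertionSort r S.toList
  refine ⟨S.toList.insertionSort r, hp.nodup_iff.2 S.nodup_toList, fun x => ?_, ?_, ?_⟩
  · rw [hp.mem_iff, Finset.mem_toList]
  · rw [hp.length_eq, Finset.length_toList]
  · intro i j hi hj hij
    rcases hij.eq_or_lt with rfl | hij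
    · exact le_rfl
    · exact List.pairwise_iff_getElem.1 (List.pairwise_insertionSort r S.toList) i j hi hj hij

/-- If the complement of `M` is a clique, a vertex of `M` is adjacent to every vertex of `W` of
smaller or equal weight, and `G` has no path on `|V| + 1 - q` vertices, then below some threshold
there are at least `q` more vertices of `M` than of `W`. -/
lemma exists_threshold (G : SimpleGraph V) (M W : Finset V) (g : V → ℕ) (q ℓ : ℕ) (hq : 1 ≤ q)
    (hℓ : ℓ + q = Fintype.card V + 1) (hMW : Disjoint M W)
    (hclique : ∀ u v, u ∉ M → v ∉ M → u ≠ v → G.Adj u v)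
    (hadj : ∀ v ∈ M, ∀ u ∈ W, g u ≤ g v → G.Adj v u) (hno : ¬ HasPath G ℓ) :
    ∃ θ, q + (W.filter fun u => g u ≤ θ).card ≤ (M.filter fun v => g v ≤ θ).card ∧
      2 * (W.filter fun u => g u ≤ θ).card + 1 + q ≤ Fintype.card V := by
  obtain ⟨LM, hMnd, hMmem, hMlen, hMsort⟩ := exists_sorted_list M g
  obtain ⟨ws, hWnd, hWmem, hWlen, hWsort⟩ := exists_sorted_list W g
  obtain ⟨vs, hvs⟩ : ∃ vs, vs = LM.drop (q - 1) := ⟨_, rfl⟩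
  have hvsnd : vs.Nodup := hvs ▸ hMnd.drop
  have hvsM : ∀ x ∈ vs, x ∈ M := fun x hx => (hMmem x).1 (List.mem_of_mem_drop (hvs ▸ hx))
  have hvslen : vs.length = LM.length - (q - 1) := by rw [hvs, List.length_drop]
  have hvsget : ∀ i (hi : i < vs.length), vs[i] = LM[q - 1 + i] := by
    intro i hi
    subst hvs
    rw [List.getElem_drop]
  have hvssort : ∀ i j (hi : i < vs.length) (hj : j < vs.length), i ≤ j → g vs[i] ≤ g vs[j] := by
    intro i j hi hj hij
    rw [hvsget i hi, hvsget j hj]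
    exact hMsort _ _ _ _ (by omega)
  have hnodup : ∀ k, (vs.take k ++ ws.take k).Nodup := by
    intro k
    rw [List.nodup_append]
    refine ⟨hvsnd.take, hWnd.take, fun a ha b hb hab => ?_⟩
    subst hab
    exact Finset.disjoint_left.1 hMW (hvsM a (List.mem_of_mem_take ha))
      ((hWmem a).1 (List.mem_of_mem_take hb))
  have halt : ∀ k, k ≤ vs.length →
      (∀ j, j < k → ∃ (hj : j < ws.length) (hjv : j < vs.length), g ws[j] ≤ g vs[j]) →
      k ≤ ws.length ∧
      (∀ i j (hi : i < vs.length) (hj : j < ws.length), j < k → j ≤ i → G.Adj vs[i] ws[j]) := by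
    intro k hk hgood
    refine ⟨?_, fun i j hi hj hjk hji => ?_⟩
    · rcases Nat.eq_zero_or_pos k with rfl | hk0
      · omega
      · obtain ⟨h, -⟩ := hgood (k - 1) (by omega)
        omega
    · obtain ⟨_, h1, h2⟩ := hgood j hjk
      exact hadj _ (hvsM _ (List.getElem_mem _)) _ ((hWmem _).1 (List.getElem_mem _))
        (h2.trans (hvssort j i h1 hi hji))
  by_cases hall : ∀ j, j < vs.length →
      ∃ (hj : j < ws.length) (hjv : j < vs.length), g ws[j] ≤ g vs[j]
  · exfalso
    obtain ⟨hkw, had⟩ := halt _ le_rfl hall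
    obtain ⟨l, hp, hc, hlast⟩ := exists_alternating_list vs ws _ le_rfl hkw had
    have hlnd : l.Nodup := hp.nodup_iff.2 (hnodup _)
    set R : Finset V := (Mᶜ \ (ws.take vs.length).toFinset) with hR
    have hRmem : ∀ x, x ∈ R ↔ x ∉ M ∧ x ∉ ws.take vs.length := by
      intro x
      rw [hR, Finset.mem_sdiff, Finset.mem_compl, List.mem_toFinset]
    have hwsM : ∀ x ∈ ws.take vs.length, x ∉ M := fun x hx hxM =>
      Finset.disjoint_left.1 hMW hxM ((hWmem x).1 (List.mem_of_mem_take hx))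
    refine hno ⟨l ++ R.toList, ?_, ?_, ?_⟩
    · rw [List.nodup_append]
      refine ⟨hlnd, R.nodup_toList, fun a ha b hb hab => ?_⟩
      subst hab
      rw [Finset.mem_toList, hRmem] at hb
      rw [hp.mem_iff, List.mem_append] at ha
      rcases ha with ha | ha
      · exact hb.1 (hvsM _ (List.mem_of_mem_take ha))
      · exact hb.2 ha
    · refine hc.append ?_ ?_
      · refine List.Pairwise.isChain ?_
        refine List.Pairwise.imp_of_mem ?_ (R.nodup_toList)
        intro a b ha hb hab
        rw [Finset.mem_toList, hRmem] at ha hb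
        exact hclique a b ha.1 hb.1 hab
      · intro x hx y hy
        have hy' := List.mem_of_mem_head? hy
        rw [Finset.mem_toList, hRmem] at hy'
        refine hclique x y (hwsM _ (hlast x hx)) hy'.1 ?_
        rintro rfl
        exact hy'.2 (hlast x hx)
    · rw [List.length_append, Finset.length_toList, hp.length_eq, List.length_append,
        List.length_take, List.length_take, hR, Finset.card_sdiff_of_subset,
        List.toFinset_card_of_nodup hWnd.take, List.length_take, Finset.card_compl]
      · have := Finset.card_le_univ M
        omega
      · intro x hx
        rw [Finset.mem_compl]
        exact hwsM x (List.mem_toFinset.1 hx)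
  · have hex : ∃ j, j < vs.length ∧
        ¬ ∃ (hj : j < ws.length) (hjv : j < vs.length), g ws[j] ≤ g vs[j] := by
      push Not at hall ⊢
      exact hall
    obtain ⟨i, ⟨hi, hbad⟩, hmin⟩ : ∃ i, (i < vs.length ∧
        ¬ ∃ (hj : i < ws.length) (hjv : i < vs.length), g ws[i] ≤ g vs[i]) ∧
        ∀ j, j < i → ∃ (hj : j < ws.length) (hjv : j < vs.length), g ws[j] ≤ g vs[j] := by
      refine ⟨Nat.find hex, Nat.find_spec hex, fun j hj => ?_⟩
      have h1 := Nat.find_min hex hj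
      have h2 := (Nat.find_spec hex).1
      by_contra hcon
      exact h1 ⟨by omega, hcon⟩
    obtain ⟨hkw, had⟩ := halt i hi.le hmin
    obtain ⟨l, hp, hc, hlast⟩ := exists_alternating_list vs ws i hi.le hkw had
    have hlnd : l.Nodup := hp.nodup_iff.2 (hnodup _)
    have hlen : 2 * i + 1 < ℓ := by
      by_contra hcon
      refine hno ⟨l ++ [vs[i]], ?_, ?_, ?_⟩
      · rw [List.nodup_append]
        refine ⟨hlnd, by simp, fun a ha b hb hab => ?_⟩
        rw [List.mem_singleton] at hb
        subst hb
        subst hab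
        rw [hp.mem_iff, List.mem_append] at ha
        rcases ha with ha | ha
        · obtain ⟨j, hj, he⟩ := List.mem_take_iff_getElem.1 ha
          have := (List.Nodup.getElem_inj_iff hvsnd).1 he
          omega
        · exact Finset.disjoint_left.1 hMW (hvsM _ (List.getElem_mem _))
            ((hWmem _).1 (List.mem_of_mem_take ha))
      · refine hc.append (by simp) ?_
        intro x hx y hy
        obtain ⟨j, hj, rfl⟩ := List.mem_take_iff_getElem.1 (hlast x hx)
        simp at hy
        rw [← hy]
        exact (had i j hi (by omega) (by omega) (by omega)).symm
      · rw [List.length_append, hp.length_eq, List.length_append, List.length_take,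
          List.length_take, List.length_singleton]
        omega
    have hWle : (W.filter fun u => g u ≤ g vs[i]).card ≤ i := by
      calc _ ≤ (ws.take i).toFinset.card := by
            apply Finset.card_le_card
            intro x hx
            rw [Finset.mem_filter, ← hWmem] at hx
            obtain ⟨⟨j, hj, rfl⟩, hle⟩ := List.mem_iff_getElem.1 hx.1, hx.2
            rw [List.mem_toFinset, List.mem_take_iff_getElem]
            refine ⟨j, ?_, rfl⟩
            by_contra hji
            have hji : i ≤ j := by omega
            exact hbad ⟨by omega, hi, (hWsort i j (by omega) hj hji).trans hle⟩
        _ ≤ i := (List.toFinset_card_le _).trans (by simp)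
    have hMge : q + i ≤ (M.filter fun v => g v ≤ g vs[i]).card := by
      calc q + i = (LM.take (q + i)).toFinset.card := by
            rw [List.toFinset_card_of_nodup hMnd.take, List.length_take]
            omega
        _ ≤ _ := by
            apply Finset.card_le_card
            intro x hx
            obtain ⟨j, hj, rfl⟩ := List.mem_take_iff_getElem.1 (List.mem_toFinset.1 hx)
            rw [Finset.mem_filter, hvsget i hi]
            exact ⟨(hMmem _).1 (List.getElem_mem _), hMsort _ _ _ _ (by omega)⟩
    exact ⟨g vs[i], by omega, by omega⟩

lemma card_le_deg_add_deg_add_one {G H : SimpleGraph V} (h : ∀ u v, u ≠ v → G.Adj u v ∨ H.Adj u v)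
    (v : V) : Fintype.card V ≤ deg G v + deg H v + 1 := by
  have h1 : Finset.univ.erase v ⊆
      (Finset.univ.filter fun w => G.Adj v w) ∪ (Finset.univ.filter fun w => H.Adj v w) := by
    intro w hw
    simpa using h v w (Finset.ne_of_mem_erase hw).symm
  have h2 := (Finset.card_le_card h1).trans (Finset.card_union_le _ _)
  rw [Finset.card_erase_of_mem (Finset.mem_univ v), Finset.card_univ] at h2
  rw [deg, deg]
  omega

lemma two_pow_succ_sub_one_mul (m q : ℕ) :
    (2 ^ (m + 1) - 1) * q = 2 * ((2 ^ m - 1) * q) + q := by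
  obtain ⟨p, hp⟩ : ∃ p, 2 ^ m = p + 1 :=
    ⟨2 ^ m - 1, by have := Nat.one_le_two_pow (n := m); omega⟩
  have : 2 ^ (m + 1) - 1 = 2 * p + 1 := by rw [pow_succ]; omega
  rw [this, hp, Nat.add_sub_cancel]
  ring

lemma two_pow_sub_one_mul_le_sum {ι : Type*} (q : ℕ) (θ b e : ι → ℕ) (hb : ∀ j, q + e j ≤ b j)
    (he : ∀ (j : ι) (S : Finset ι), j ∉ S → (∀ i ∈ S, θ i ≤ θ j) → ∑ i ∈ S, b i ≤ e j) :
    ∀ (m : ℕ) (S : Finset ι), S.card = m → (2 ^ m - 1) * q ≤ ∑ i ∈ S, b i := by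
  intro m
  induction m with
  | zero => simp
  | succ m ih =>
    intro S hS
    obtain ⟨j, hj, hmax⟩ := S.exists_max_image θ (Finset.card_pos.1 (by omega))
    have h1 := ih (S.erase j) (by rw [Finset.card_erase_of_mem hj, hS]; rfl)
    have h2 := he j (S.erase j) (Finset.notMem_erase j S)
      (fun i hi => hmax i (Finset.mem_of_mem_erase hi))
    have h3 := hb j
    rw [← Finset.add_sum_erase S b hj]
    have h4 := two_pow_succ_sub_one_mul m q
    omega

theorem two_pow_sub_one_mul_lt_card_of_closed {t : ℕ} (ht : 1 ≤ t) (G : Fin t → SimpleGraph V)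
    (q ℓ : ℕ) (hq : 1 ≤ q) (hℓ : ℓ + q = Fintype.card V + 1) (hno : ∀ i, ¬ HasPath (G i) ℓ)
    (hclosed : ∀ i u v, u ≠ v → ¬ (G i).Adj u v → deg (G i) u + deg (G i) v + 2 ≤ Fintype.card V)
    (hcover : ∀ i j, i ≠ j → ∀ u v, u ≠ v → (G i).Adj u v ∨ (G j).Adj u v) :
    (2 ^ t - 1) * q < Fintype.card V := by
  set M : Fin t → Finset V := fun i =>
    Finset.univ.filter fun v => 2 * deg (G i) v + 2 ≤ Fintype.card V with hM
  have hMmem : ∀ i v, v ∈ M i ↔ 2 * deg (G i) v + 2 ≤ Fintype.card V := by simp [hM]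
  have hsum : ∀ i j, i ≠ j → ∀ v, Fintype.card V ≤ deg (G i) v + deg (G j) v + 1 :=
    fun i j hij => card_le_deg_add_deg_add_one (hcover i j hij)
  have hdisj : ∀ i j, i ≠ j → ∀ v, v ∈ M i → v ∉ M j := by
    intro i j hij v hi hj
    rw [hMmem] at hi hj
    have := hsum i j hij v
    omega
  obtain ⟨g, hg⟩ : ∃ g : V → ℕ, ∀ i, ∀ v ∈ M i, g v = deg (G i) v := by
    refine ⟨fun v => if h : ∃ i, v ∈ M i then deg (G h.choose) v else 0, fun i v hv => ?_⟩
    have h : ∃ i, v ∈ M i := ⟨i, hv⟩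
    have hi : h.choose = i := by
      by_contra hne
      exact hdisj _ _ hne v h.choose_spec hv
    simp only [dif_pos h, hi]
  set W : Fin t → Finset V := fun j => (Finset.univ.erase j).biUnion M with hW
  have hWmem : ∀ j v, v ∈ W j ↔ ∃ i, i ≠ j ∧ v ∈ M i := by simp [hW]
  have hth : ∀ j, ∃ θ, q + ((W j).filter fun u => g u ≤ θ).card ≤
      ((M j).filter fun v => g v ≤ θ).card ∧
      2 * ((W j).filter fun u => g u ≤ θ).card + 1 + q ≤ Fintype.card V := by
    intro j
    refine exists_threshold (G j) (M j) (W j) g q ℓ hq hℓ ?_ ?_ ?_ (hno j)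
    · rw [Finset.disjoint_left]
      intro v hv hv'
      obtain ⟨i, hij, hi⟩ := (hWmem j v).1 hv'
      exact hdisj i j hij v hi hv
    · intro u v hu hv huv
      by_contra hn
      have := hclosed j u v huv hn
      rw [hMmem] at hu hv
      omega
    · intro v hv u hu hle
      obtain ⟨i, hij, hi⟩ := (hWmem j u).1 hu
      rw [hg j v hv, hg i u hi] at hle
      by_contra hn
      have h1 := hclosed j v u (by rintro rfl; exact hdisj i j hij v hi hv) hn
      have h2 := hsum i j hij u
      omega
  choose θ hb hn using hth
  have he : ∀ (j : Fin t) (S : Finset (Fin t)), j ∉ S → (∀ i ∈ S, θ i ≤ θ j) →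
      ∑ i ∈ S, ((M i).filter fun v => g v ≤ θ i).card ≤ ((W j).filter fun u => g u ≤ θ j).card := by
    intro j S hj hS
    rw [← Finset.card_biUnion]
    · apply Finset.card_le_card
      intro v hv
      obtain ⟨i, hi, hv⟩ := Finset.mem_biUnion.1 hv
      rw [Finset.mem_filter] at hv ⊢
      exact ⟨(hWmem j v).2 ⟨i, by rintro rfl; exact hj hi, hv.1⟩, hv.2.trans (hS i hi)⟩
    · intro i _ k _ hik
      refine Finset.disjoint_left.2 ?_
      intro v hv hv'
      exact hdisj i k hik v (Finset.mem_filter.1 hv).1 (Finset.mem_filter.1 hv').1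
  have hne : (Finset.univ : Finset (Fin t)).Nonempty := ⟨⟨0, ht⟩, Finset.mem_univ _⟩
  obtain ⟨j, -, hmax⟩ := Finset.univ.exists_max_image θ hne
  have h1 := two_pow_sub_one_mul_le_sum q θ _ _ hb he (t - 1) (Finset.univ.erase j)
    (by rw [Finset.card_erase_of_mem (Finset.mem_univ j), Finset.card_univ, Fintype.card_fin])
  have h2 := he j (Finset.univ.erase j) (Finset.notMem_erase j _)
    (fun i _ => hmax i (Finset.mem_univ i))
  have h3 := hn j
  have h4 := two_pow_succ_sub_one_mul (t - 1) q
  rw [Nat.sub_add_cancel ht] at h4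
  omega

end

lemma avoidsPath_of_hasPath {n t ℓ : ℕ} {c : Sym2 (Fin n) → Fin t} {i : Fin t}
    {G : SimpleGraph (Fin n)} (hG : ∀ u v, G.Adj u v → c s(u, v) ≠ i) (h : HasPath G ℓ) :
    AvoidsPath n t ℓ c i := by
  obtain ⟨l, hnd, hc, hl⟩ := h
  refine ⟨fun k => l[(k : ℕ)]'(by omega), fun a b hab => ?_, fun k hk => ?_⟩
  · exact Fin.ext ((List.Nodup.getElem_inj_iff hnd).1 hab)
  · exact hG _ _ (List.isChain_iff_getElem.1 hc k (by omega))

theorem isChromRamsey_of_le {t ℓ n q : ℕ} (ht : 1 ≤ t) (hq : 1 ≤ q) (hℓ : ℓ + q = n + 1)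
    (hn : n ≤ (2 ^ t - 1) * q) : IsChromRamsey t (fun _ => ℓ) n := by
  intro c
  by_contra! hcon
  let G : Fin t → SimpleGraph (Fin n) := fun i =>
    { Adj := fun u v => u ≠ v ∧ c s(u, v) ≠ i
      symm := ⟨fun u v h => ⟨h.1.symm, by rw [Sym2.eq_swap]; exact h.2⟩⟩
      loopless := ⟨fun v h => h.1 rfl⟩ }
  have hno : ∀ i, ¬ HasPath (G i) ℓ := fun i h =>
    hcon i (avoidsPath_of_hasPath (G := G i) (fun u v huv => huv.2) h)
  choose G' hle hno' hclosed using fun i => exists_closed_supergraph (hno i)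
  have := two_pow_sub_one_mul_lt_card_of_closed ht G' q ℓ hq (by simpa using hℓ) hno' hclosed ?_
  · rw [Fintype.card_fin] at this
    omega
  · intro i j hij u v huv
    by_cases h : c s(u, v) = i
    · exact Or.inr (hle j ⟨huv, fun h' => hij (h.symm.trans h')⟩)
    · exact Or.inl (hle i ⟨huv, h⟩)

lemma card_level_le_card_below_add_one {ℓ i : ℕ} {f : ℕ → ℕ}
    (hf : ∀ k, k + 1 < ℓ → min (f k) (f (k + 1)) ≠ i) :
    ((Finset.range ℓ).filter fun k => f k = i).card ≤
      ((Finset.range ℓ).filter fun k => f k < i).card + 1 := by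
  refine (Nat.sub_le_iff_le_add.1 (Finset.pred_card_le_card_erase (a := ℓ - 1))).trans ?_
  refine Nat.add_le_add_right ?_ 1
  refine Finset.card_le_card_of_injOn (fun k => k + 1) ?_ (fun a _ b _ h => Nat.succ.inj h)
  intro k hk
  simp only [Finset.coe_erase, Finset.coe_filter, Finset.mem_range, Set.mem_sdiff, Set.mem_ofPred_eq,
    Set.mem_singleton_iff] at hk ⊢
  have := hf k (by omega)
  omega

lemma card_level_le_card_below {ℓ i b : ℕ} {f : ℕ → ℕ}
    (hf : ∀ k, k + 1 < ℓ → min (f k) (f (k + 1)) ≠ i) (hb : b < ℓ) (hib : i < f b) :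
    ((Finset.range ℓ).filter fun k => f k = i).card ≤
      ((Finset.range ℓ).filter fun k => f k < i).card := by
  have hlt : ∀ k, k < ℓ → f k = i → k < b → f (k + 1) < i := by
    intro k hk hki hkb
    have := hf k (by omega)
    omega
  have hgt : ∀ k, k < ℓ → f k = i → b < k → f (k - 1) < i := by
    intro k hk hki hkb
    have := hf (k - 1) (by omega)
    rw [Nat.sub_add_cancel (by omega)] at this
    omega
  have hne : ∀ k, f k = i → k ≠ b := by
    rintro k hk rfl
    omega
  refine Finset.card_le_card_of_injOn (fun k => if k < b then k + 1 else k - 1) ?_ ?_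
  · intro k hk
    simp only [Finset.coe_filter, Finset.mem_range, Set.mem_ofPred_eq] at hk ⊢
    have := hne k hk.2
    split_ifs with h
    · exact ⟨by omega, hlt k hk.1 hk.2 h⟩
    · exact ⟨by omega, hgt k hk.1 hk.2 (by omega)⟩
  · intro k hk m hm hkm
    simp only [Finset.coe_filter, Finset.mem_range, Set.mem_ofPred_eq] at hk hm hkm
    have h1 := hne k hk.2
    have h2 := hne m hm.2
    split_ifs at hkm with h3 h4 h4
    · omega
    · have h5 := hlt k hk.1 hk.2 h3
      have : k + 1 ≠ b := by rintro h; rw [h] at h5; omega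
      omega
    · have h5 := hlt m hm.1 hm.2 h4
      have : m + 1 ≠ b := by rintro h; rw [h] at h5; omega
      omega
    · omega

/-- The number of the block containing `x` when `ℕ` is cut at the points `(2 ^ i - 1) * s`
for `i < t`. -/
def blockIndex (t s x : ℕ) : ℕ := Nat.findGreatest (fun i => (2 ^ i - 1) * s ≤ x) (t - 1)

lemma le_blockIndex_iff {t s x i : ℕ} (hi : i ≤ t - 1) :
    i ≤ blockIndex t s x ↔ (2 ^ i - 1) * s ≤ x := by
  refine ⟨fun h => ?_, fun h => Nat.le_findGreatest hi h⟩
  have h1 : (2 ^ blockIndex t s x - 1) * s ≤ x :=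
    Nat.findGreatest_spec (P := fun i => (2 ^ i - 1) * s ≤ x) (Nat.zero_le (t - 1)) (by simp)
  refine le_trans ?_ h1
  gcongr
  norm_num

lemma blockIndex_le (t s x : ℕ) : blockIndex t s x ≤ t - 1 := Nat.findGreatest_le _

theorem not_isChromRamsey_of_lt {t ℓ n s : ℕ} (ht : 2 ≤ t) (hℓ : 2 ≤ ℓ)
    (hs : (2 ^ t - 2) * s ≤ ℓ - 2) (hn : n < ℓ + s) : ¬ IsChromRamsey t (fun _ => ℓ) n := by
  intro h
  let lev : Fin n → ℕ := fun x => blockIndex t s x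
  have hlev : ∀ x, lev x ≤ t - 1 := fun x => blockIndex_le t s x
  let c : Sym2 (Fin n) → Fin t := Sym2.lift
    ⟨fun x y => ⟨min (lev x) (lev y), by have := hlev x; omega⟩,
      fun x y => by simp only [min_comm]⟩
  obtain ⟨i, P, hP, hPi⟩ := h c
  let p : ℕ → ℕ := fun k => if hk : k < ℓ then (P ⟨k, hk⟩ : ℕ) else 0
  have hp : ∀ k (hk : k < ℓ), p k = P ⟨k, hk⟩ := fun k hk => dif_pos hk
  have hpn : ∀ k, k < ℓ → p k < n := fun k hk => by rw [hp k hk]; exact (P ⟨k, hk⟩).isLt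
  have hinj : Set.InjOn p {k | k < ℓ} := by
    intro a ha b hb hab
    rw [hp a ha, hp b hb] at hab
    simpa using hP (Fin.ext hab)
  obtain ⟨f, hfdef⟩ : ∃ f : ℕ → ℕ, ∀ k, f k = blockIndex t s (p k) := ⟨_, fun _ => rfl⟩
  have hf : ∀ k, k + 1 < ℓ → min (f k) (f (k + 1)) ≠ i := by
    intro k hk he
    refine hPi k hk (Fin.ext ?_)
    rw [hfdef, hfdef, hp k (by omega), hp (k + 1) hk] at he
    exact he
  have hi : (i : ℕ) ≤ t - 1 := by omega
  have hX : ((Finset.range ℓ).filter fun k => f k < i).card ≤ (2 ^ (i : ℕ) - 1) * s := by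
    rw [← Finset.card_range ((2 ^ (i : ℕ) - 1) * s)]
    refine Finset.card_le_card_of_injOn p ?_ (hinj.mono ?_)
    · intro k hk
      simp only [Finset.coe_filter, Finset.mem_range, Set.mem_ofPred_eq, Finset.coe_range,
        Set.mem_Iio] at hk ⊢
      have := le_blockIndex_iff (s := s) (x := p k) hi
      rw [← hfdef] at this
      omega
    · intro k hk
      simp at hk
      exact hk.1
  have hsplit : ℓ = ((Finset.range ℓ).filter fun k => f k < i).card +
      ((Finset.range ℓ).filter fun k => f k = i).card +
      ((Finset.range ℓ).filter fun k => i < f k).card := by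
    rw [← Finset.card_union_of_disjoint, ← Finset.card_union_of_disjoint]
    · conv_lhs => rw [← Finset.card_range ℓ]
      congr 1
      ext k
      simp only [Finset.mem_union, Finset.mem_filter]
      have := lt_trichotomy (f k) i
      tauto
    · rw [← Finset.filter_or, Finset.disjoint_filter]
      intros
      omega
    · rw [Finset.disjoint_filter]
      intros
      omega
  rcases Finset.eq_empty_or_nonempty ((Finset.range ℓ).filter fun k => i < f k) with hB | ⟨b, hb⟩
  · have hA := card_level_le_card_below_add_one hf
    rw [hB, Finset.card_empty] at hsplit
    have hle : 2 * ((2 ^ (i : ℕ) - 1) * s) ≤ (2 ^ t - 2) * s := by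
      rw [← mul_assoc]
      gcongr
      have : 2 ^ ((i : ℕ) + 1) ≤ 2 ^ t := Nat.pow_le_pow_right (by norm_num) (by omega)
      rw [pow_succ] at this
      omega
    omega
  · rw [Finset.mem_filter, Finset.mem_range] at hb
    have hA := card_level_le_card_below hf hb.1 hb.2
    have hi' : (i : ℕ) + 1 ≤ t - 1 := by
      have := blockIndex_le t s (p b)
      rw [← hfdef] at this
      omega
    have hcut : ∀ k, i < f k ↔ (2 ^ ((i : ℕ) + 1) - 1) * s ≤ p k := by
      intro k
      rw [← le_blockIndex_iff hi', hfdef]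
      exact Iff.rfl
    have hBcard : ((Finset.range ℓ).filter fun k => i < f k).card ≤
        n - (2 ^ ((i : ℕ) + 1) - 1) * s := by
      rw [← Nat.card_Ico]
      refine Finset.card_le_card_of_injOn p ?_ (hinj.mono ?_)
      · intro k hk
        simp only [Finset.coe_filter, Finset.mem_range, Set.mem_ofPred_eq, Finset.coe_Ico,
          Set.mem_Ico] at hk ⊢
        exact ⟨(hcut k).1 hk.2, hpn k hk.1⟩
      · intro k hk
        simp at hk
        exact hk.1
    have hbn := hpn b hb.1
    have hbc := (hcut b).1 hb.2
    have hdouble := two_pow_succ_sub_one_mul i s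
    omega

/-- The `(t-1)`-chromatic Ramsey number of the path on `ℓ` vertices equals
`ℓ + ⌊(ℓ-2)/(2^t-2)⌋`, and this number is the least `N` such that every `t`-colouring of
`K_N` contains a path on `ℓ` vertices avoiding some colour. -/
theorem path_chromatic_ramsey (t ℓ : ℕ) (ht : 2 ≤ t) (hℓ : 2 ≤ ℓ) :
    pRamsey t (fun _ => ℓ) = ℓ + (ℓ - 2) / (2 ^ t - 2) ∧
    IsLeast {N | IsChromRamsey t (fun _ => ℓ) N} (ℓ + (ℓ - 2) / (2 ^ t - 2)) := by
  have hpow : 2 ^ 2 ≤ 2 ^ t := Nat.pow_le_pow_right (by norm_num) ht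
  have hleast : IsLeast {N | IsChromRamsey t (fun _ => ℓ) N} (ℓ + (ℓ - 2) / (2 ^ t - 2)) := by
    constructor
    · refine isChromRamsey_of_le (q := (ℓ - 2) / (2 ^ t - 2) + 1) (by omega)
        (Nat.le_add_left 1 _) rfl ?_
      have h1 := Nat.lt_mul_div_succ (ℓ - 2) (show 0 < 2 ^ t - 2 by omega)
      have h2 : (2 ^ t - 1) * ((ℓ - 2) / (2 ^ t - 2) + 1) =
          (2 ^ t - 2) * ((ℓ - 2) / (2 ^ t - 2) + 1) + ((ℓ - 2) / (2 ^ t - 2) + 1) := by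
        rw [show 2 ^ t - 1 = (2 ^ t - 2) + 1 by omega, Nat.succ_mul]
      omega
    · intro N hN
      by_contra! hlt
      exact not_isChromRamsey_of_lt ht hℓ (Nat.mul_div_le _ _) hlt hN
  exact ⟨hleast.csInf_eq, hleast⟩
end

section
/- Let t ≥ 3 and 2 ≤ ℓ₁ ≤ ℓ₂ ≤ ... ≤ ℓ_t be integers. If ℓ_t < p(ℓ₁,...,ℓ_{t−1}), then p(ℓ₁,...,ℓ_t) = ⌊(ℓ₁ + 2ℓ₂ + ... + 2^{t−1}ℓ_t − 2)/(2^t − 2)⌋; otherwise p(ℓ₁,...,ℓ_t) = p(ℓ₁,...,ℓ_{t−1}). -/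
namespace PathRamsey

open Finset

variable {V : Type*}

/-- `G` has a path on `m` vertices, all of them in `U`. -/
def HasPathOn (G : SimpleGraph V) (U : Finset V) (m : ℕ) : Prop :=
  ∃ p : List V, p.Nodup ∧ (∀ x ∈ p, x ∈ U) ∧ p.length = m ∧ p.IsChain G.Adj

theorem HasPathOn.mono_length {G : SimpleGraph V} {U : Finset V} {m k : ℕ}
    (h : HasPathOn G U m) (hk : k ≤ m) : HasPathOn G U k := by
  obtain ⟨p, hn, hU, hl, hc⟩ := h
  exact ⟨p.take k, hn.sublist (List.take_sublist k p), fun x hx => hU x (List.mem_of_mem_take hx),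
    by simp [hl, hk], hc.take k⟩

theorem isChain_or_exists_adjacent {R S : V → V → Prop} (p : List V)
    (hp : p.IsChain (fun a b => R a b ∨ S a b)) :
    p.IsChain R ∨ ∃ A B a b, p = A ++ a :: b :: B ∧ S a b := by
  induction p with
  | nil => exact Or.inl List.IsChain.nil
  | cons x l ih =>
    cases l with
    | nil => exact Or.inl (List.IsChain.singleton x)
    | cons y l =>
      rw [List.isChain_cons_cons] at hp
      rcases hp.1 with h | h
      · rcases ih hp.2 with h' | ⟨A, B, a, b, h', hS⟩
        · exact Or.inl (List.isChain_cons_cons.2 ⟨h, h'⟩)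
        · exact Or.inr ⟨x :: A, B, a, b, by simp [h'], hS⟩
      · exact Or.inr ⟨[], l, x, y, rfl, h⟩

theorem isChain_of_isChain_sup_edge {G : SimpleGraph V} {u v a b : V} {p : List V}
    (hp : p.IsChain (G ⊔ SimpleGraph.edge u v).Adj) (hab : a = u ∧ b = v ∨ a = v ∧ b = u)
    (h : a ∉ p) : p.IsChain G.Adj := by
  rw [List.isChain_iff_getElem] at hp ⊢
  intro i hi
  have h1 := hp i hi
  have h2 : p[i] ≠ a := fun h' => h (h' ▸ List.getElem_mem _)
  have h3 : p[i + 1] ≠ a := fun h' => h (h' ▸ List.getElem_mem _)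
  rw [SimpleGraph.sup_adj, SimpleGraph.edge_adj] at h1
  grind

/-- A path using an added edge `uv` falls into a path ending at `u` and one starting at `v`. -/
theorem isChain_or_split {G : SimpleGraph V} {u v : V} {p : List V} (hn : p.Nodup)
    (hp : p.IsChain (G ⊔ SimpleGraph.edge u v).Adj) :
    p.IsChain G.Adj ∨ ∃ X Y : List V, p.Perm ((u :: X) ++ (v :: Y)) ∧
      (u :: X).IsChain G.Adj ∧ (v :: Y).IsChain G.Adj := by
  have hp' : p.IsChain (fun a b => G.Adj a b ∨ (SimpleGraph.edge u v).Adj a b) := hp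
  rcases isChain_or_exists_adjacent p hp' with h | ⟨A, B, a, b, rfl, hS⟩
  · exact Or.inl h
  right
  have hab : a = u ∧ b = v ∨ a = v ∧ b = u := ((SimpleGraph.edge_adj _ _ _ _).1 hS).1
  rw [List.append_cons] at hp
  have h1 := List.isChain_append.1 hp
  have hA : (A ++ [a]).IsChain G.Adj := by
    refine isChain_of_isChain_sup_edge (a := b) (b := a) h1.1 (by tauto) ?_
    grind
  have hB : (b :: B).IsChain G.Adj := by
    refine isChain_of_isChain_sup_edge (a := a) (b := b) h1.2.1 (by tauto) ?_
    grind
  have hA' : (a :: A.reverse).IsChain G.Adj := by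
    have h2 : ((a :: A.reverse).reverse).IsChain G.Adj := by simpa using hA
    rw [List.isChain_reverse] at h2
    exact h2.imp fun _ _ h => h.symm
  have hperm : (A ++ a :: b :: B).Perm ((a :: A.reverse) ++ (b :: B)) := by
    rw [List.append_cons]
    refine List.Perm.append_right _ ?_
    exact List.perm_append_comm.trans (by simp)
  rcases hab with ⟨rfl, rfl⟩ | ⟨rfl, rfl⟩
  · exact ⟨_, _, hperm, hA', hB⟩
  · exact ⟨_, _, hperm.trans List.perm_append_comm, hB, hA'⟩

theorem countP_add_countP_le (α β : V → Bool) (x : V) (l : List V)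
    (hlast : ∀ y ∈ (x :: l).getLast?, β y = false)
    (hsplit : ∀ A y z B, x :: l = A ++ y :: z :: B → β y = true → α z = false) :
    l.countP α + (x :: l).countP β ≤ l.length := by
  induction l generalizing x with
  | nil => simpa using hlast
  | cons y l ih =>
    have h1 := ih y (by simpa using hlast)
      (fun A a b B h => hsplit (x :: A) a b B (by simp [h]))
    have h2 := hsplit [] x y l rfl
    rw [List.countP_cons (l := l) (p := α), List.countP_cons (a := x) (p := β)]
    simp only [List.length_cons]
    cases hx : β x <;> cases hy : α y <;> simp_all <;> omega

/-- Rotation: either a path starting at `u` can be rearranged to end at a neighbour of `v`, or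
`u` and `v` have few neighbours on it in total. -/
theorem exists_rotation_or_countP_le (G : SimpleGraph V) [DecidableRel G.Adj] {u v : V}
    {l : List V} (hl : (u :: l).IsChain G.Adj) (huv : ¬ G.Adj u v) :
    (∃ Z : List V, Z.Perm (u :: l) ∧ Z.IsChain G.Adj ∧ ∀ z ∈ Z.getLast?, G.Adj z v) ∨
      (u :: l).countP (G.Adj u ·) + (u :: l).countP (G.Adj v ·) ≤ l.length := by
  have huv' : ¬ G.Adj v u := fun h => huv h.symm
  cases l with
  | nil => right; simp [huv']
  | cons x l =>
    by_contra! hcon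
    obtain ⟨h1, h2⟩ := hcon
    have key := countP_add_countP_le (G.Adj u ·) (G.Adj v ·) x l ?_ ?_
    · simp only [List.countP_cons, huv', SimpleGraph.irrefl] at h2 key
      simp only [List.length_cons] at h2
      split_ifs at h2 key <;> simp_all <;> omega
    · intro y hy
      by_contra hvy
      obtain ⟨z, hz, hzv⟩ := h1 _ (List.Perm.refl _) hl
      rw [List.getLast?_cons_cons] at hz
      have : y = z := by grind
      subst this
      simp at hvy
      exact hzv hvy.symm
    · intro A y z B hAB hvy
      by_contra huz
      simp only [decide_eq_true_eq, Bool.not_eq_false] at hvy huz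
      rw [hAB] at hl
      have hl1 : ((u :: A) ++ [y]).IsChain G.Adj ∧ (z :: B).IsChain G.Adj := by
        have h3 : (((u :: A) ++ [y]) ++ z :: B).IsChain G.Adj := by simpa using hl
        exact ⟨(List.isChain_append.1 h3).1, (List.isChain_append.1 h3).2.1⟩
      have hchain : (((z :: B).reverse) ++ (u :: (A ++ [y]))).IsChain G.Adj := by
        rw [List.isChain_append]
        refine ⟨?_, by simpa using hl1.1, ?_⟩
        · rw [List.isChain_reverse]
          exact hl1.2.imp fun _ _ h => h.symm
        · simp
          exact huz.symm
      have hperm : ((z :: B).reverse ++ (u :: (A ++ [y]))).Perm (u :: x :: l) := by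
        rw [hAB]
        refine List.perm_append_comm.trans ?_
        simp only [List.cons_append, List.append_assoc, List.perm_cons]
        refine List.Perm.append_left _ ?_
        simp only [List.nil_append, List.perm_cons]
        exact List.reverse_perm (z :: B)
      obtain ⟨w, hw, hwv⟩ := h1 _ hperm hchain
      rw [← List.cons_append, ← List.append_assoc, List.getLast?_append] at hw
      simp at hw
      subst hw
      exact hwv hvy.symm

theorem card_filter_toFinset_le [DecidableEq V] (q : V → Prop) [DecidablePred q] (l : List V) :
    (l.toFinset.filter q).card ≤ l.countP (q ·) := by
  have h : l.toFinset.filter q = (l.filter (q ·)).toFinset := by ext; simp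
  rw [h, List.countP_eq_length_filter]
  exact List.toFinset_card_le _

/-- Adding an edge between non-adjacent vertices of large degree sum creates no longer path. -/
theorem hasPathOn_of_sup_edge [DecidableEq V] {G : SimpleGraph V} [DecidableRel G.Adj]
    {U : Finset V} {u v : V} {m : ℕ} (huv : ¬ G.Adj u v)
    (hdeg : U.card ≤ (U.filter (G.Adj u ·)).card + (U.filter (G.Adj v ·)).card + 1)
    (h : HasPathOn (G ⊔ SimpleGraph.edge u v) U m) : HasPathOn G U m := by
  obtain ⟨p, hn, hU, hlen, hp⟩ := h
  rcases isChain_or_split hn hp with hp | ⟨X, Y, hperm, hX, hY⟩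
  · exact ⟨p, hn, hU, hlen, hp⟩
  have hvu : ¬ G.Adj v u := fun h => huv h.symm
  have hXr : (u :: X).reverse.IsChain G.Adj := by
    rw [List.isChain_reverse]
    exact hX.imp fun _ _ h => h.symm
  rcases exists_rotation_or_countP_le G hX huv with ⟨Z, hZp, hZ, hZv⟩ | hcX
  · have hq : (Z ++ (v :: Y)).Perm p := (hZp.append_right _).trans hperm.symm
    refine ⟨_, hq.nodup_iff.2 hn, fun x hx => hU x (hq.mem_iff.1 hx), hq.length_eq.trans hlen, ?_⟩
    rw [List.isChain_append]
    exact ⟨hZ, hY, by simpa using hZv⟩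
  rcases exists_rotation_or_countP_le G hY hvu with ⟨Z, hZp, hZ, hZu⟩ | hcY
  · have hq : (Z ++ (u :: X)).Perm p :=
      ((hZp.append_right _).trans List.perm_append_comm).trans hperm.symm
    refine ⟨_, hq.nodup_iff.2 hn, fun x hx => hU x (hq.mem_iff.1 hx), hq.length_eq.trans hlen, ?_⟩
    rw [List.isChain_append]
    exact ⟨hZ, hX, by simpa using hZu⟩
  by_cases hw : ∃ w ∈ U, w ∉ p ∧ G.Adj u w ∧ G.Adj v w
  · obtain ⟨w, hwU, hwp, huw, hvw⟩ := hw
    have hq : ((u :: X).reverse ++ w :: (v :: Y)).Perm (w :: p) := by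
      refine List.perm_middle.trans (List.Perm.cons w ?_)
      exact ((List.reverse_perm (u :: X)).append_right _).trans hperm.symm
    refine HasPathOn.mono_length (m := m + 1) ⟨_, hq.nodup_iff.2 (List.nodup_cons.2 ⟨hwp, hn⟩),
      fun x hx => ?_, by rw [hq.length_eq, List.length_cons, hlen], ?_⟩ (Nat.le_succ m)
    · rcases List.mem_cons.1 (hq.mem_iff.1 hx) with rfl | h
      · exact hwU
      · exact hU x h
    · rw [List.isChain_append]
      refine ⟨hXr, List.isChain_cons_cons.2 ⟨hvw.symm, hY⟩, ?_⟩
      simpa using huw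
  exfalso
  push Not at hw
  have hcover : ∀ q : V → Prop, ∀ [DecidablePred q], (U.filter q).card ≤
      (u :: X).countP (q ·) + (v :: Y).countP (q ·) + ((U \ p.toFinset).filter q).card := by
    intro q _
    have hsub : U.filter q ⊆ (((u :: X).toFinset.filter q) ∪ ((v :: Y).toFinset.filter q)) ∪
        ((U \ p.toFinset).filter q) := by
      intro x hx
      have := hperm.mem_iff (a := x)
      simp only [List.mem_append] at this
      simp only [mem_union, mem_filter, mem_sdiff, List.mem_toFinset] at hx ⊢
      tauto
    refine (card_le_card hsub).trans ((card_union_le _ _).trans (Nat.add_le_add_right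
      ((card_union_le _ _).trans (Nat.add_le_add ?_ ?_)) _))
    · exact card_filter_toFinset_le q _
    · exact card_filter_toFinset_le q _
  have h1 := hcover (G.Adj u ·)
  have h2 := hcover (G.Adj v ·)
  have h3 : ((U \ p.toFinset).filter (G.Adj u ·)).card +
      ((U \ p.toFinset).filter (G.Adj v ·)).card ≤ (U \ p.toFinset).card := by
    rw [← card_union_of_disjoint]
    · exact card_le_card (union_subset (filter_subset _ _) (filter_subset _ _))
    · rw [disjoint_left]
      intro x hx hx'
      simp only [mem_filter, mem_sdiff, List.mem_toFinset] at hx hx'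
      exact hw x hx.1.1 hx.1.2 hx.2 hx'.2
  have h4 : (U \ p.toFinset).card + p.length = U.card := by
    rw [← List.toFinset_card_of_nodup hn]
    exact card_sdiff_add_card_eq_card fun x hx => hU x (List.mem_toFinset.1 hx)
  have h5 := hperm.length_eq
  simp only [List.length_append, List.length_cons] at h5
  omega

theorem HasPathOn.mono_set {G : SimpleGraph V} {U W : Finset V} {m : ℕ} (hUW : U ⊆ W)
    (h : HasPathOn G U m) : HasPathOn G W m := by
  obtain ⟨p, hn, hU, hl, hc⟩ := h
  exact ⟨p, hn, fun x hx => hUW (hU x hx), hl, hc⟩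

theorem hasPathOn_of_le_one {G : SimpleGraph V} {U : Finset V} {v : V} (hv : v ∈ U) {m : ℕ}
    (hm : m ≤ 1) : HasPathOn G U m :=
  HasPathOn.mono_length ⟨[v], by simp, by simpa using hv, rfl, by simp⟩ hm

/-- A path avoiding a universal vertex and leaving out another vertex extends by two. -/
theorem hasPathOn_add_two [DecidableEq V] {G : SimpleGraph V} {U : Finset V} {v : V} {m : ℕ}
    (hv : v ∈ U) (huniv : ∀ w ∈ U, w ≠ v → G.Adj v w) (hm : m + 2 ≤ U.card)
    (h : HasPathOn G (U.erase v) m) : HasPathOn G U (m + 2) := by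
  obtain ⟨p, hn, hU, hl, hc⟩ := h
  have hvp : v ∉ p := fun h => by simpa using hU v h
  obtain ⟨z, hz, hzp⟩ : ∃ z ∈ U.erase v, z ∉ p.toFinset := by
    by_contra! hcon
    have h1 := card_le_card hcon
    rw [card_erase_of_mem hv, List.toFinset_card_of_nodup hn] at h1
    omega
  rw [mem_erase] at hz
  rw [List.mem_toFinset] at hzp
  refine ⟨z :: v :: p, ?_, ?_, by simp [hl], ?_⟩
  · simp [hz.1, hzp, hvp, hn]
  · intro x hx
    simp only [List.mem_cons] at hx
    rcases hx with rfl | rfl | hx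
    exacts [hz.2, hv, mem_of_mem_erase (hU x hx)]
  · refine List.isChain_cons_cons.2 ⟨(huniv z hz.2 hz.1).symm, ?_⟩
    cases p with
    | nil => simp
    | cons y p =>
      have hy := hU y (by simp)
      rw [mem_erase] at hy
      exact List.isChain_cons_cons.2 ⟨huniv y hy.2 hy.1, hc⟩

/-- If every pair of vertices is adjacent in all but at most one of the graphs `G i`, none of
which has a path on `L i` vertices, then the graphs can be enlarged, keeping the latter property,
so that some vertex is universal in all but one of them. -/
theorem exists_universal [Finite V] {ι : Type*} [Finite ι] {T : Finset ι} (hT : T.Nonempty)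
    {U : Finset V} (hU : U.Nonempty) {G : ι → SimpleGraph V} {L : ι → ℕ}
    (hG : ∀ i ∈ T, ∀ j ∈ T, i ≠ j → ∀ u v, u ≠ v → (G i).Adj u v ∨ (G j).Adj u v)
    (hL : ∀ i ∈ T, ¬ HasPathOn (G i) U (L i)) :
    ∃ H : ι → SimpleGraph V, G ≤ H ∧ (∀ i ∈ T, ¬ HasPathOn (H i) U (L i)) ∧
      ∃ i ∈ T, ∃ v ∈ U, ∀ j ∈ T, j ≠ i → ∀ w ∈ U, w ≠ v → (H j).Adj v w := by
  classical
  obtain ⟨H, hGH, hH⟩ := Finite.exists_le_maximal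
    (p := fun H : ι → SimpleGraph V => ∀ i ∈ T, ¬ HasPathOn (H i) U (L i)) hL
  refine ⟨H, hGH, hH.prop, ?_⟩
  obtain ⟨⟨i, v⟩, hiv, hmin⟩ := (T ×ˢ U).exists_min_image
    (fun x => (U.filter ((H x.1).Adj x.2 ·)).card) (hT.product hU)
  rw [mem_product] at hiv
  refine ⟨i, hiv.1, v, hiv.2, fun j hj hji w hw hwv => ?_⟩
  by_contra hvw
  have h1 : (U.filter ((H j).Adj v ·)).card + (U.filter ((H j).Adj w ·)).card + 1 < U.card := by
    by_contra! hdeg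
    let H' := Function.update H j (H j ⊔ SimpleGraph.edge v w)
    have hle : H ≤ H' := by
      simp only [H', le_update_iff]
      exact ⟨le_sup_left, fun _ _ => le_rfl⟩
    have hbad : ¬ ∀ i ∈ T, ¬ HasPathOn (H' i) U (L i) := fun hgood => by
      have h2 : (H' j).Adj v w := by
        simp [H', SimpleGraph.edge_adj, hwv.symm]
      exact hvw (hH.le_of_ge hgood hle j h2)
    push Not at hbad
    obtain ⟨k, hk, hpath⟩ := hbad
    by_cases hkj : k = j
    · subst hkj
      simp only [H', Function.update_self] at hpath
      exact hH.prop k hk (hasPathOn_of_sup_edge hvw hdeg hpath)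
    · simp only [H', Function.update_of_ne hkj] at hpath
      exact hH.prop k hk hpath
  have h2 : U.card ≤ (U.filter ((H i).Adj v ·)).card + (U.filter ((H j).Adj v ·)).card + 1 := by
    rw [← card_erase_add_one hiv.2]
    refine Nat.add_le_add_right (le_trans (card_le_card fun x hx => ?_) (card_union_le _ _)) 1
    rw [mem_erase] at hx
    simp only [mem_union, mem_filter, hx.2, true_and]
    exact (hG i hiv.1 j hj hji.symm v x hx.1.symm).imp (fun h => hGH i h) (fun h => hGH j h)
  have h3 := hmin (j, w) (mem_product.2 ⟨hj, hw⟩)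
  simp only at h3
  omega

/-- Weights dominating the sequence `1, 2, 4, …` in the sense of partial sums, none of them
exceeding one plus the sum of the others. -/
structure IsBinaryWeight {ι : Type*} (T : Finset ι) (w : ι → ℕ) : Prop where
  two_pow_card_le : ∀ S ⊆ T, 2 ^ S.card ≤ 1 + ∑ i ∈ S, w i
  two_mul_le : ∀ i ∈ T, 2 * w i ≤ 1 + ∑ j ∈ T, w j

theorem IsBinaryWeight.exists_insert {ι : Type*} [DecidableEq ι] {T : Finset ι} {w : ι → ℕ}
    (hw : IsBinaryWeight T w) {i : ι} (hi : i ∉ T) :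
    ∃ w' : ι → ℕ, IsBinaryWeight (insert i T) w' ∧ w' i = 1 + ∑ j ∈ T, w j ∧
      ∀ j ∈ T, w' j = w j := by
  have hne : ∀ j ∈ T, j ≠ i := fun j hj h => hi (h ▸ hj)
  have hup : ∀ j ∈ T, Function.update w i (1 + ∑ j ∈ T, w j) j = w j := fun j hj =>
    Function.update_of_ne (hne j hj) _ _
  refine ⟨Function.update w i (1 + ∑ j ∈ T, w j), ⟨fun S hS => ?_, fun j hj => ?_⟩, by simp, hup⟩
  · by_cases hiS : i ∈ S
    · have hsub : S.erase i ⊆ T := by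
        intro x hx
        rw [mem_erase] at hx
        exact (mem_insert.1 (hS hx.2)).resolve_left hx.1
      have h1 := hw.two_pow_card_le _ hsub
      have h2 : ∑ j ∈ S.erase i, w j ≤ ∑ j ∈ T, w j := sum_le_sum_of_subset hsub
      have h3 : ∑ j ∈ S.erase i, Function.update w i (1 + ∑ j ∈ T, w j) j = ∑ j ∈ S.erase i, w j :=
        sum_congr rfl fun j hj => hup j (hsub hj)
      rw [← add_sum_erase S _ hiS, h3, ← card_erase_add_one hiS, pow_succ, Function.update_self]
      omega
    · have hsub : S ⊆ T := fun x hx =>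
        (mem_insert.1 (hS hx)).resolve_left fun h => hiS (h ▸ hx)
      rw [sum_congr rfl fun j hj => hup j (hsub hj)]
      exact hw.two_pow_card_le S hsub
  · have hT : ∑ j ∈ T, Function.update w i (1 + ∑ j ∈ T, w j) j = ∑ j ∈ T, w j :=
      sum_congr rfl hup
    rw [sum_insert hi, hT, Function.update_self]
    rcases mem_insert.1 hj with rfl | hj
    · rw [Function.update_self]
      omega
    · rw [hup j hj]
      have := hw.two_mul_le j hj
      omega

/-- If every pair of vertices is adjacent in all but at most one of the graphs `G i`, and the
longest path of `G i` misses at least `e i ≥ 1` vertices, then a suitably weighted sum of the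
`e i` is less than the number of vertices. -/
theorem exists_weight_sum_lt [Finite V] {ι : Type*} [Finite ι] (n : ℕ) (T : Finset ι)
    (U : Finset V) (hU : U.card = n + 1) (G : ι → SimpleGraph V) (e : ι → ℕ)
    (hG : ∀ i ∈ T, ∀ j ∈ T, i ≠ j → ∀ u v, u ≠ v → (G i).Adj u v ∨ (G j).Adj u v)
    (he : ∀ i ∈ T, 1 ≤ e i)
    (hL : ∀ i ∈ T, ¬ HasPathOn (G i) U (n + 2 - e i)) :
    ∃ w, IsBinaryWeight T w ∧ ∑ i ∈ T, w i * e i ≤ n := by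
  classical
  induction n generalizing T U G e with
  | zero =>
    obtain ⟨v, hv⟩ : U.Nonempty := card_pos.1 (by omega)
    obtain rfl : T = ∅ := by
      rw [eq_empty_iff_forall_notMem]
      intro i hi
      have := he i hi
      exact hL i hi (hasPathOn_of_le_one hv (by omega))
    exact ⟨0, ⟨by simp, by simp⟩, by simp⟩
  | succ n ih =>
    rcases T.eq_empty_or_nonempty with rfl | hT
    · exact ⟨0, ⟨by simp, by simp⟩, by simp⟩
    obtain ⟨H, hGH, hH, i, hi, v, hv, huniv⟩ :=
      exists_universal hT (card_pos.1 (by omega)) hG hL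
    have hHT : ∀ i ∈ T, ∀ j ∈ T, i ≠ j → ∀ u v, u ≠ v → (H i).Adj u v ∨ (H j).Adj u v :=
      fun i hi j hj hij u v huv => (hG i hi j hj hij u v huv).imp (fun h => hGH i h)
        (fun h => hGH j h)
    have hcard : (U.erase v).card = n + 1 := by rw [card_erase_of_mem hv, hU]; rfl
    have hother : ∀ j ∈ T, j ≠ i → ¬ HasPathOn (H j) (U.erase v) (n + 2 - (e j + 1)) := by
      intro j hj hji hpath
      have h1 : 2 ≤ n + 1 + 2 - e j := by
        by_contra! hlt
        exact hH j hj (hasPathOn_of_le_one hv (by omega))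
      have h2 := he j hj
      have h3 := hasPathOn_add_two hv (huniv j hj hji) (by omega) hpath
      exact hH j hj (h3.mono_length (by omega))
    have hsame : ¬ HasPathOn (H i) (U.erase v) (n + 2 - (e i - 1)) := by
      intro hpath
      have := he i hi
      exact hH i hi ((hpath.mono_set (erase_subset v U)).mono_length (by omega))
    rcases (he i hi).eq_or_lt with hei | hei
    · obtain ⟨w, hw, hsum⟩ := ih (T.erase i) (U.erase v) hcard H (fun j => e j + 1)
        (fun j hj k hk => hHT j (mem_of_mem_erase hj) k (mem_of_mem_erase hk))
        (fun j _ => Nat.le_add_left 1 _)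
        (fun j hj => hother j (mem_of_mem_erase hj) (ne_of_mem_erase hj))
      obtain ⟨w', hw', hwi, hwj⟩ := hw.exists_insert (notMem_erase i T)
      rw [insert_erase hi] at hw'
      refine ⟨w', hw', ?_⟩
      have hcongr : ∑ j ∈ T.erase i, w' j * e j = ∑ j ∈ T.erase i, w j * e j :=
        sum_congr rfl fun j hj => by rw [hwj j hj]
      rw [← add_sum_erase T _ hi, hwi, ← hei, hcongr]
      simp only [mul_add, sum_add_distrib, mul_one] at hsum ⊢
      omega
    · obtain ⟨w, hw, hsum⟩ := ih T (U.erase v) hcard H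
        (fun j => if j = i then e i - 1 else e j + 1) hHT
        (fun j _ => by split_ifs <;> omega) (fun j hj => by
          split_ifs with hji
          · exact hji ▸ hsame
          · exact hother j hj hji)
      refine ⟨w, hw, ?_⟩
      have h1 := hw.two_mul_le i hi
      have hcongr : ∑ j ∈ T.erase i, w j * (if j = i then e i - 1 else e j + 1) =
          ∑ j ∈ T.erase i, w j * (e j + 1) :=
        sum_congr rfl fun j hj => by rw [if_neg (ne_of_mem_erase hj)]
      rw [← add_sum_erase T _ hi] at h1 hsum ⊢
      rw [if_pos rfl, hcongr] at hsum
      simp only [mul_add, sum_add_distrib, mul_one] at hsum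
      obtain ⟨k, hk⟩ := Nat.exists_eq_add_of_lt hei
      rw [hk] at hsum ⊢
      have : w i * (1 + k + 1) = w i * (1 + k + 1 - 1) + w i := by
        rw [show 1 + k + 1 - 1 = 1 + k by omega]; ring
      omega

theorem IsBinaryWeight.sum_two_pow_mul_le {t : ℕ} {w : Fin t → ℕ} (hw : IsBinaryWeight univ w)
    {e : Fin t → ℕ} (he : Antitone e) : ∑ j : Fin t, 2 ^ (j : ℕ) * e j ≤ ∑ j, w j * e j := by
  suffices h : ∀ (t : ℕ) (w e : Fin t → ℤ),
      (∀ S : Finset (Fin t), (2 : ℤ) ^ S.card ≤ 1 + ∑ j ∈ S, w j) → Antitone e →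
      ∀ d, (∀ j, d ≤ e j) →
      ∑ j : Fin t, 2 ^ (j : ℕ) * e j + (1 + ∑ j, w j - 2 ^ t) * d ≤ ∑ j, w j * e j by
    have := h t (fun j => w j) (fun j => e j)
      (fun S => by exact_mod_cast hw.two_pow_card_le S (subset_univ S))
      (fun i j hij => Int.ofNat_le.2 (he hij)) 0 (fun j => Int.natCast_nonneg _)
    rw [mul_zero, add_zero] at this
    exact_mod_cast this
  intro t
  induction t with
  | zero => intro w e _ _ d _; simp
  | succ t ih =>
    intro w e hw he d hd
    have h1 := ih (fun j => w j.castSucc) (fun j => e j.castSucc)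
      (fun S => by simpa using hw (S.map Fin.castSuccEmb))
      (fun i j hij => he (Fin.castSucc_le_castSucc_iff.2 hij)) (e (Fin.last t))
      (fun j => he (Fin.le_last _))
    have h2 := hw univ
    have h3 := hd (Fin.last t)
    simp only [card_univ, Fintype.card_fin, Fin.sum_univ_castSucc, Fin.val_castSucc,
      Fin.val_last, pow_succ] at h1 h2 ⊢
    nlinarith [mul_nonneg (sub_nonneg.2 h2) (sub_nonneg.2 h3)]

/-- The graph of the edges avoiding colour `i`. -/
def avoidGraph {n t : ℕ} (c : Sym2 (Fin n) → Fin t) (i : Fin t) : SimpleGraph (Fin n) where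
  Adj a b := a ≠ b ∧ c s(a, b) ≠ i
  symm := ⟨fun a b h => ⟨h.1.symm, by rw [Sym2.eq_swap]; exact h.2⟩⟩
  loopless := ⟨fun a h => h.1 rfl⟩

theorem avoidsPath_iff_hasPathOn {n t ℓ : ℕ} {c : Sym2 (Fin n) → Fin t} {i : Fin t} :
    AvoidsPath n t ℓ c i ↔ HasPathOn (avoidGraph c i) univ ℓ := by
  constructor
  · rintro ⟨P, hP, hc⟩
    refine ⟨List.ofFn P, List.nodup_ofFn.2 hP, fun x _ => mem_univ x, List.length_ofFn, ?_⟩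
    rw [List.isChain_iff_getElem]
    intro k hk
    rw [List.length_ofFn] at hk
    simp only [List.getElem_ofFn]
    exact ⟨hP.ne (by simp), hc k hk⟩
  · rintro ⟨p, hn, -, rfl, hc⟩
    rw [List.isChain_iff_getElem] at hc
    exact ⟨p.get, List.nodup_iff_injective_get.1 hn, fun k hk => (hc k hk).2⟩

theorem sum_two_pow_mul_sub {t N : ℕ} {ℓ : Fin t → ℕ} (hℓ : ∀ i, ℓ i ≤ N) :
    ∑ j : Fin t, 2 ^ (j : ℕ) * (N - ℓ j) + ∑ j : Fin t, 2 ^ (j : ℕ) * ℓ j = (2 ^ t - 1) * N := by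
  have h : ∑ j ∈ range t, 2 ^ j = 2 ^ t - 1 := by simpa using Nat.geomSum_eq le_rfl t
  rw [← sum_add_distrib, ← h, ← Fin.sum_univ_eq_sum_range, sum_mul]
  exact sum_congr rfl fun j _ => by rw [← mul_add, Nat.sub_add_cancel (hℓ j)]

theorem le_sum_of_not_isChromRamsey {t n : ℕ} {ℓ : Fin t → ℕ} (hmono : Monotone ℓ)
    (hn : 1 ≤ n) (hℓ : ∀ i, ℓ i ≤ n) (h : ¬ IsChromRamsey t ℓ n) :
    (2 ^ t - 2) * (n + 1) + 2 ≤ ∑ i : Fin t, 2 ^ (i : ℕ) * ℓ i := by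
  rw [IsChromRamsey] at h
  push Not at h
  obtain ⟨c, hc⟩ := h
  obtain ⟨m, rfl⟩ := Nat.exists_eq_add_of_le' hn
  obtain ⟨w, hw, hsum⟩ := exists_weight_sum_lt m univ (univ : Finset (Fin (m + 1)))
    (by simp) (avoidGraph c) (fun i => m + 2 - ℓ i)
    (fun i _ j _ hij u v huv => by
      by_cases h : c s(u, v) = i
      · exact Or.inr ⟨huv, h ▸ hij⟩
      · exact Or.inl ⟨huv, h⟩)
    (fun i _ => by have := hℓ i; omega)
    (fun i _ => by
      have := hℓ i
      rw [Nat.sub_sub_self (by omega), ← avoidsPath_iff_hasPathOn]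
      exact hc i)
  have h1 := (hw.sum_two_pow_mul_le (e := fun i => m + 2 - ℓ i)
    fun i j hij => Nat.sub_le_sub_left (hmono hij) _).trans hsum
  have h2 := sum_two_pow_mul_sub (N := m + 2) fun i => (hℓ i).trans (Nat.le_succ _)
  have ht : 2 ^ 1 ≤ 2 ^ t := Nat.pow_le_pow_right two_pos (c s(0, 0)).pos
  obtain ⟨a, ha⟩ := Nat.exists_eq_add_of_le' ht
  rw [ha] at h2 ⊢
  simp only [pow_one, Nat.add_sub_cancel, Nat.add_succ_sub_one] at h2 ⊢
  nlinarith

theorem isChromRamsey_mono {t n m : ℕ} {ℓ : Fin t → ℕ} (hnm : n ≤ m)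
    (h : IsChromRamsey t ℓ n) : IsChromRamsey t ℓ m := by
  intro c
  obtain ⟨i, P, hP, hc⟩ := h fun e => c (e.map (Fin.castLE hnm))
  exact ⟨i, Fin.castLE hnm ∘ P, (Fin.castLE_injective hnm).comp hP, hc⟩

/-- A path all of whose edges have their smaller end below `b` or at least `b'` alternates, between
`b` and `b'`, with vertices below `b`. -/
theorem countP_le_of_isChain (b b' : ℕ) (hb : b ≤ b') (l : List ℕ)
    (hl : l.IsChain fun x y => min x y < b ∨ b' ≤ min x y) :
    ∃ d ≤ 1, (0 < l.countP (b' ≤ ·) → d = 0) ∧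
      l.countP (fun x => b ≤ x ∧ x < b') ≤ l.countP (· < b) + d ∧
      ∀ x ∈ l.head?, x < b → l.countP (fun x => b ≤ x ∧ x < b') + 1 ≤ l.countP (· < b) + d := by
  refine ⟨if 0 < l.countP (b' ≤ ·) then 0 else 1, by split_ifs <;> omega, fun h => if_pos h, ?_⟩
  induction l with
  | nil => simp
  | cons x l ih =>
    obtain ⟨h1, h2⟩ := ih hl.tail
    have h3 : ∀ y ∈ l.head?, min x y < b ∨ b' ≤ min x y := by
      cases l with
      | nil => simp
      | cons y l => simpa using (List.isChain_cons_cons.1 hl).1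
    cases l with
    | nil => simp [List.countP_cons]; split_ifs <;> omega
    | cons y l =>
      have h3 := h3 y rfl
      have h2 := h2 y rfl
      rw [List.countP_cons (a := x), List.countP_cons (a := x), List.countP_cons (a := x)]
      simp only [decide_eq_true_eq, List.head?_cons, Option.mem_def, Option.some.injEq,
        forall_eq'] at *
      rw [List.countP_cons (p := fun x => decide (b' ≤ x)) (a := y)] at *
      simp only [decide_eq_true_eq] at *
      split_ifs at * <;> omega

theorem length_le_of_isChain {b b' n : ℕ} (hb : b ≤ b') {l : List ℕ} (hn : l.Nodup)
    (hln : ∀ x ∈ l, x < n) (hl : l.IsChain fun x y => min x y < b ∨ b' ≤ min x y) :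
    l.length ≤ 2 * b + max 1 (n - b') := by
  obtain ⟨d, hd, hd', h, -⟩ := countP_le_of_isChain b b' hb l hl
  have hlen : ∀ l : List ℕ, l.length = l.countP (· < b) + l.countP (fun x => b ≤ x ∧ x < b') +
      l.countP (b' ≤ ·) := by
    intro l
    induction l with
    | nil => simp
    | cons x l ih =>
      simp only [List.length_cons, List.countP_cons, ih, decide_eq_true_eq]
      split_ifs <;> omega
  have hcount : ∀ (q : ℕ → Prop) [DecidablePred q] (s : Finset ℕ), (∀ x ∈ l, q x → x ∈ s) →
      l.countP (q ·) ≤ s.card := by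
    intro q _ s hs
    rw [List.countP_eq_length_filter, ← List.toFinset_card_of_nodup (hn.filter _)]
    refine card_le_card fun x hx => ?_
    simp only [List.mem_toFinset, List.mem_filter, decide_eq_true_eq] at hx
    exact hs x hx.1 hx.2
  have hB := hcount (· < b) (range b) fun x _ hx => mem_range.2 hx
  have hD := hcount (b' ≤ ·) (Ico b' n) fun x hx hx' => mem_Ico.2 ⟨hx', hln x hx⟩
  rw [card_range] at hB
  rw [Nat.card_Ico] at hD
  have := hlen l
  omega

theorem not_isChromRamsey_of_le_sum {t n : ℕ} {ℓ : Fin (t + 1) → ℕ}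
    (hℓ : ∀ i, ℓ i ≤ n + 1)
    (h : (2 ^ (t + 1) - 2) * (n + 1) + 2 ≤ ∑ i : Fin (t + 1), 2 ^ (i : ℕ) * ℓ i) :
    ¬ IsChromRamsey (t + 1) ℓ n := by
  obtain ⟨L, hL, hLℓ⟩ : ∃ L : ℕ → ℕ, (∀ i, L i ≤ n + 1) ∧ ∀ i : Fin (t + 1), L i = ℓ i :=
    ⟨fun i => if hi : i < t + 1 then ℓ ⟨i, hi⟩ else 0,
      fun i => by dsimp only; split_ifs; exacts [hℓ _, Nat.zero_le _], fun i => dif_pos i.isLt⟩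
  set b : ℕ → ℕ := fun i => ∑ j ∈ range (t - i), 2 ^ j * (n + 1 - L (i + 1 + j)) with hb
  have hbt : b t = 0 := by simp [hb]
  have hbs : ∀ i < t, b i = 2 * b (i + 1) + (n + 1 - L (i + 1)) := by
    intro i hi
    obtain ⟨k, rfl⟩ := Nat.exists_eq_add_of_lt hi
    simp only [hb]
    rw [show i + k + 1 - i = k + 1 by omega, show i + k + 1 - (i + 1) = k by omega,
      sum_range_succ', mul_sum]
    simp only [pow_zero, one_mul, add_zero]
    congr 1
    exact sum_congr rfl fun j _ => by
      rw [pow_succ', mul_assoc, show i + 1 + 1 + j = i + 1 + (j + 1) by omega]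
  have hb0 : 2 * b 0 + 2 ≤ L 0 := by
    have h1 := sum_two_pow_mul_sub hℓ
    have h2 : ∑ j : Fin (t + 1), 2 ^ (j : ℕ) * (n + 1 - ℓ j) = 2 * b 0 + (n + 1 - L 0) := by
      simp only [← hLℓ]
      rw [Fin.sum_univ_eq_sum_range (fun j => 2 ^ j * (n + 1 - L j)), sum_range_succ']
      simp only [hb, mul_sum, pow_zero, one_mul, Nat.sub_zero]
      congr 1
      exact sum_congr rfl fun j _ => by rw [pow_succ', mul_assoc, show 0 + 1 + j = j + 1 by omega]
    have h3 := hL 0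
    have h4 : 2 ^ 1 ≤ 2 ^ (t + 1) := Nat.pow_le_pow_right two_pos (by omega)
    obtain ⟨a, ha⟩ := Nat.exists_eq_add_of_le' h4
    rw [ha] at h h1
    simp only [pow_one, Nat.add_sub_cancel, Nat.add_succ_sub_one] at h h1
    have h5 : (a + 1) * (n + 1) = a * (n + 1) + (n + 1) := by ring
    omega
  have hanti : ∀ i ≤ t, ∀ k ≤ i, b i ≤ b k := by
    intro i hi k hk
    induction i, hk using Nat.le_induction with
    | base => exact le_rfl
    | succ i hki ih =>
      have := ih (by omega)
      have := hbs i (by omega)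
      omega
  have hex : ∀ m, ∃ i, b i ≤ m := fun m => ⟨t, by simp [hbt]⟩
  have hlt : ∀ m, Nat.find (hex m) < t + 1 := fun m =>
    Nat.lt_succ_of_le (Nat.find_min' _ (by simp [hbt]))
  intro hR
  set c : Sym2 (Fin n) → Fin (t + 1) := fun e => ⟨Nat.find (hex e.inf), hlt _⟩ with hcdef
  obtain ⟨⟨i, hi⟩, hpath⟩ := hR c
  rw [avoidsPath_iff_hasPathOn] at hpath
  obtain ⟨p, hn, -, hlen, hc⟩ := hpath
  have hn' : (p.map Fin.val).Nodup := hn.map Fin.val_injective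
  have hpn : ∀ x ∈ p.map Fin.val, x < n := by simp
  have hc' : ∀ x y : Fin n, (avoidGraph c ⟨i, hi⟩).Adj x y →
      min (x : ℕ) y < b i ∨ ∃ k < i, b k ≤ min (x : ℕ) y := by
    intro x y hxy
    by_contra! hcon
    refine hxy.2 (Fin.ext ?_)
    simp only [hcdef, Nat.find_eq_iff]
    exact ⟨hcon.1, fun k hk => not_le.2 (hcon.2 k hk)⟩
  have hlen' : p.length = L i := hlen.trans (hLℓ ⟨i, hi⟩).symm
  cases i with
  | zero =>
    have := length_le_of_isChain (b := b 0) (b' := max n (b 0)) (le_max_right _ _) hn' hpn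
      ((List.isChain_map _).2 (hc.imp fun x y hxy => Or.inl ((hc' x y hxy).resolve_right (by simp))))
    rw [List.length_map] at this
    omega
  | succ k =>
    have h1 := hbs k (by omega)
    have := length_le_of_isChain (b := b (k + 1)) (b' := b k) (by omega) hn' hpn
      ((List.isChain_map _).2 (hc.imp fun x y hxy => by
        refine (hc' x y hxy).imp_right ?_
        rintro ⟨j, hj, hj'⟩
        exact (hanti k (by omega) j (by omega)).trans hj'))
    rw [List.length_map] at this
    have h2 := hanti k (by omega) 0 (by omega)
    have h3 := hL (k + 1)
    have h4 := hL 0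
    omega

theorem isChromRamsey_pRamsey {t : ℕ} (ht : 2 ≤ t) {ℓ : Fin t → ℕ} (hmono : Monotone ℓ) :
    IsChromRamsey t ℓ (pRamsey t ℓ) := by
  refine Nat.sInf_mem (s := {n | IsChromRamsey t ℓ n}) ⟨∑ i : Fin t, 2 ^ (i : ℕ) * ℓ i + 1, ?_⟩
  by_contra h
  have h1 : ∀ i, ℓ i ≤ ∑ i : Fin t, 2 ^ (i : ℕ) * ℓ i + 1 := fun i =>
    (Nat.le_mul_of_pos_left _ (by positivity)).trans ((single_le_sum
      (f := fun i : Fin t => 2 ^ (i : ℕ) * ℓ i) (fun _ _ => Nat.zero_le _) (mem_univ i)).trans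
      (Nat.le_succ _))
  have h2 := le_sum_of_not_isChromRamsey hmono (Nat.le_add_left 1 _) h1 h
  have h3 : 2 ^ 2 ≤ 2 ^ t := Nat.pow_le_pow_right two_pos ht
  have h4 := Nat.mul_le_mul_right (∑ i : Fin t, 2 ^ (i : ℕ) * ℓ i + 1 + 1)
    (show 1 ≤ 2 ^ t - 2 by omega)
  omega

theorem pRamsey_eq_of_isChromRamsey {t n : ℕ} {ℓ : Fin t → ℕ} (h : IsChromRamsey t ℓ n)
    (h' : ∀ m < n, ¬ IsChromRamsey t ℓ m) : pRamsey t ℓ = n := by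
  refine le_antisymm (Nat.sInf_le h) (le_csInf ⟨n, h⟩ fun m hm => ?_)
  by_contra! hlt
  exact h' m hlt hm

theorem le_of_avoidsPath {n t ℓ : ℕ} {c : Sym2 (Fin n) → Fin t} {i : Fin t}
    (h : AvoidsPath n t ℓ c i) : ℓ ≤ n := by
  obtain ⟨P, hP, -⟩ := h
  simpa using Fintype.card_le_of_injective P hP

theorem pRamsey_castSucc_of_lt {t : ℕ} (ht : 2 ≤ t) {ℓ : Fin (t + 1) → ℕ} (hmono : Monotone ℓ)
    (h2 : 2 ≤ ℓ 0) (h : ℓ (Fin.last t) < pRamsey t fun i => ℓ i.castSucc) :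
    pRamsey (t + 1) ℓ = sVal (t + 1) ℓ := by
  have hlast : ∀ i, ℓ i ≤ ℓ (Fin.last t) := fun i => hmono (Fin.le_last i)
  have h2' : 2 ≤ ℓ (Fin.last t) := h2.trans (hlast 0)
  have h1 := le_sum_of_not_isChromRamsey (fun i j hij => hmono (Fin.castSucc_le_castSucc_iff.2 hij))
    (by omega) (fun i => hlast i.castSucc) (Nat.notMem_of_lt_sInf h)
  have hpow : 2 ^ 2 ≤ 2 ^ t := Nat.pow_le_pow_right two_pos ht
  have hpos : 0 < 2 ^ (t + 1) - 2 := by rw [pow_succ]; omega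
  have hsum : ∑ i : Fin (t + 1), 2 ^ (i : ℕ) * ℓ i =
      ∑ i : Fin t, 2 ^ (i : ℕ) * ℓ i.castSucc + 2 ^ t * ℓ (Fin.last t) := by
    rw [Fin.sum_univ_castSucc]; rfl
  have hM : ℓ (Fin.last t) ≤ sVal (t + 1) ℓ := by
    rw [sVal, Nat.le_div_iff_mul_le hpos, hsum]
    obtain ⟨a, ha⟩ := Nat.exists_eq_add_of_le' hpow
    rw [pow_succ, ha]
    rw [ha] at h1
    refine Nat.le_sub_of_add_le ?_
    rw [show (a + 2 ^ 2) * 2 - 2 = 2 * a + 6 by omega]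
    rw [show a + 2 ^ 2 - 2 = a + 2 by omega] at h1
    nlinarith
  have hle : (2 ^ (t + 1) - 2) * sVal (t + 1) ℓ + 2 ≤ ∑ i : Fin (t + 1), 2 ^ (i : ℕ) * ℓ i := by
    have := Nat.mul_div_le (∑ i : Fin (t + 1), 2 ^ (i : ℕ) * ℓ i - 2) (2 ^ (t + 1) - 2)
    rw [sVal]
    omega
  refine pRamsey_eq_of_isChromRamsey ?_ fun m hm hR => ?_
  · by_contra hR
    have h3 := le_sum_of_not_isChromRamsey hmono (by omega) (fun i => (hlast i).trans hM) hR
    have h4 : sVal (t + 1) ℓ + 1 ≤ sVal (t + 1) ℓ := by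
      conv_rhs => rw [sVal]
      rw [Nat.le_div_iff_mul_le hpos, mul_comm]
      omega
    omega
  · obtain ⟨n, hn⟩ := Nat.exists_eq_add_of_lt (Nat.zero_lt_of_lt hm)
    rw [zero_add] at hn
    rw [hn] at hle hM hm
    exact not_isChromRamsey_of_le_sum (fun i => (hlast i).trans hM) hle
      (isChromRamsey_mono (Nat.le_of_lt_succ hm) hR)

theorem pRamsey_castSucc_of_le {t : ℕ} (ht : 2 ≤ t) {ℓ : Fin (t + 1) → ℕ} (hmono : Monotone ℓ)
    (h : (pRamsey t fun i => ℓ i.castSucc) ≤ ℓ (Fin.last t)) :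
    pRamsey (t + 1) ℓ = pRamsey t fun i => ℓ i.castSucc := by
  have hR := isChromRamsey_pRamsey ht (ℓ := fun i => ℓ i.castSucc)
    fun i j hij => hmono (Fin.castSucc_le_castSucc_iff.2 hij)
  refine pRamsey_eq_of_isChromRamsey (fun c => ?_) fun m hm hRm => ?_
  · let f : Fin (t + 1) → Fin t := fun k => if hk : k.val < t then ⟨k, hk⟩ else ⟨0, by omega⟩
    obtain ⟨i, P, hP, hc⟩ := hR fun e => f (c e)
    exact ⟨i.castSucc, P, hP, fun k hk hi => hc k hk (by simp [f, hi])⟩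
  · refine Nat.notMem_of_lt_sInf hm fun c => ?_
    obtain ⟨i, hi⟩ := hRm fun e => (c e).castSucc
    induction i using Fin.lastCases with
    | last => have := le_of_avoidsPath hi; omega
    | cast i =>
      obtain ⟨P, hP, hc⟩ := hi
      exact ⟨i, P, hP, fun k hk hi => hc k hk (congrArg Fin.castSucc hi)⟩

end PathRamsey

/-- Theorem 4 (asymmetric version): if `ℓ_t < p(ℓ₁,…,ℓ_{t-1})` then
`p(ℓ₁,…,ℓ_t) = s(ℓ₁,…,ℓ_t)`, and otherwise `p(ℓ₁,…,ℓ_t) = p(ℓ₁,…,ℓ_{t-1})`. -/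
theorem asymmetric_path_chromatic_ramsey (t : ℕ) (ht : 3 ≤ t) (ℓ : Fin t → ℕ)
    (hmono : Monotone ℓ) (h2 : 2 ≤ ℓ ⟨0, by omega⟩) :
    pRamsey t ℓ =
      if ℓ ⟨t - 1, by omega⟩ < pRamsey (t - 1) (fun i => ℓ (Fin.castLE (Nat.sub_le t 1) i)) then
        sVal t ℓ
      else pRamsey (t - 1) (fun i => ℓ (Fin.castLE (Nat.sub_le t 1) i)) := by
  obtain ⟨t, rfl⟩ : ∃ k, t = k + 1 := ⟨t - 1, by omega⟩
  split_ifs with h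
  · exact PathRamsey.pRamsey_castSucc_of_lt (by omega) hmono h2 h
  · exact PathRamsey.pRamsey_castSucc_of_le (by omega) hmono (not_lt.1 h)
end

section
/- Let t ≥ 3 and ℓ₁,...,ℓ_t ≥ 2 be integers (not necessarily sorted). If ℓ_t ≥ p(ℓ₁,...,ℓ_{t−1}), then p(ℓ₁,...,ℓ_t) = p(ℓ₁,...,ℓ_{t−1}). -/
/-- If any two elements are related by one of two relations, the first of which is
symmetric, then every list can be rearranged into a chain for the first relation followed by a
chain for the second. -/
theorem List.exists_perm_append_isChain {α : Type*} {r s : α → α → Prop}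
    (hr : ∀ a b, r a b → r b a) (hrs : ∀ a b, r a b ∨ s a b)
    (l : List α) : ∃ R S : List α, (R ++ S).Perm l ∧ R.IsChain r ∧ S.IsChain s := by
  induction l with
  | nil => exact ⟨[], [], by simp, by simp, by simp⟩
  | cons x l ih =>
    obtain ⟨R, S, hp, hR, hS⟩ := ih
    match R, S with
    | [], S => exact ⟨[x], S, by simpa using hp, by simp, hS⟩
    | a :: R, [] => exact ⟨a :: R, [x], (List.perm_append_singleton _ _).trans
        ((by simpa using hp : (a :: R).Perm l).cons x), hR, by simp⟩
    | a :: R, b :: S =>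
      by_cases hxa : r x a
      · exact ⟨x :: a :: R, b :: S, hp.cons x, by simp [hxa, hR], hS⟩
      by_cases hxb : s x b
      · exact ⟨a :: R, x :: b :: S, List.perm_middle.trans (hp.cons x), hR, by simp [hxb, hS]⟩
      have hxa' : s x a := (hrs x a).resolve_left hxa
      have hxb' : r x b := (hrs x b).resolve_right hxb
      rcases hrs a b with hab | hab
      · refine ⟨x :: b :: a :: R, S, ?_, by simp [hxb', hr _ _ hab, hR], hS.tail⟩
        exact (List.perm_middle.symm.trans hp).cons x
      · refine ⟨R, x :: a :: b :: S, ?_, hR.tail, by simp [hxa', hab, hS]⟩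
        exact List.perm_middle.trans ((List.perm_middle.trans hp).cons x)

theorem avoidsPath_of_isChain {n t m : ℕ} {c : Sym2 (Fin n) → Fin t} {i : Fin t}
    {l : List (Fin n)} (hl : l.Nodup) (hc : l.IsChain fun a b => c s(a, b) ≠ i)
    (hm : m ≤ l.length) : AvoidsPath n t m c i := by
  refine ⟨fun k => l[(k : ℕ)], fun a b hab => ?_, fun k h => ?_⟩
  · exact Fin.ext ((hl.getElem_inj_iff).1 hab)
  · exact List.isChain_iff_getElem.1 hc k (by omega)

theorem isChromRamsey_add {t : ℕ} (L : Fin t → ℕ) {i j : Fin t} (hij : i ≠ j) :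
    IsChromRamsey t L (L i + L j) := by
  intro c
  obtain ⟨R, S, hp, hR, hS⟩ := List.exists_perm_append_isChain
    (r := fun a b => c s(a, b) ≠ i) (s := fun a b => c s(a, b) ≠ j)
    (fun a b h => by rwa [Sym2.eq_swap])
    (fun a b => by
      by_contra! h
      exact hij (h.1.symm.trans h.2))
    (List.finRange (L i + L j))
  have hnd := List.nodup_append.1 (hp.nodup_iff.2 (List.nodup_finRange _))
  have hlen : R.length + S.length = L i + L j := by simpa using hp.length_eq
  rcases le_or_gt (L i) R.length with h | h
  · exact ⟨i, avoidsPath_of_isChain hnd.1 hR h⟩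
  · exact ⟨j, avoidsPath_of_isChain hnd.2.1 hS (by omega)⟩

theorem IsChromRamsey.pRamsey {t n : ℕ} {L : Fin t → ℕ} (h : IsChromRamsey t L n) :
    IsChromRamsey t L (pRamsey t L) :=
  Nat.sInf_mem (s := {n | IsChromRamsey t L n}) ⟨n, h⟩

theorem AvoidsPath.le {n t m : ℕ} {c : Sym2 (Fin n) → Fin t} {i : Fin t}
    (h : AvoidsPath n t m c i) : m ≤ n := by
  obtain ⟨P, hP, -⟩ := h
  simpa using Fintype.card_le_of_injective P hP

/-- Recolouring the last colour by any other one creates no new path avoiding a colour. -/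
theorem IsChromRamsey.of_castSucc {t : ℕ} [NeZero t] {L : Fin (t + 1) → ℕ} {n : ℕ}
    (h : IsChromRamsey t (fun i => L i.castSucc) n) : IsChromRamsey (t + 1) L n := by
  intro c
  obtain ⟨i, P, hP, hav⟩ := h fun e => Fin.lastCases 0 id (c e)
  refine ⟨i.castSucc, P, hP, fun k hk he => hav k hk ?_⟩
  simp [he]

/-- A colouring with the first `t` colours has no long path avoiding the last colour
if there are too few vertices. -/
theorem IsChromRamsey.castSucc_of_lt {t : ℕ} {L : Fin (t + 1) → ℕ} {n : ℕ}
    (h : IsChromRamsey (t + 1) L n) (hn : n < L (Fin.last t)) :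
    IsChromRamsey t (fun i => L i.castSucc) n := by
  intro c
  obtain ⟨i, hi⟩ := h fun e => (c e).castSucc
  induction i using Fin.lastCases with
  | last => exact absurd hi.le (by omega)
  | cast i =>
    obtain ⟨P, hP, hav⟩ := hi
    exact ⟨i, P, hP, fun k hk he => hav k hk (congrArg Fin.castSucc he)⟩

theorem pRamsey_succ_eq {t : ℕ} (ht : 2 ≤ t) (L : Fin (t + 1) → ℕ)
    (hge : pRamsey t (fun i => L i.castSucc) ≤ L (Fin.last t)) :
    pRamsey (t + 1) L = pRamsey t (fun i => L i.castSucc) := by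
  have : NeZero t := ⟨by omega⟩
  have hij : (⟨0, by omega⟩ : Fin t) ≠ ⟨1, by omega⟩ := by simp
  have hmem := (isChromRamsey_add (fun i : Fin t => L i.castSucc) hij).pRamsey
  have hmem' := hmem.of_castSucc.pRamsey
  refine le_antisymm (Nat.sInf_le hmem.of_castSucc) ?_
  by_contra! hlt
  exact hlt.not_ge (Nat.sInf_le (hmem'.castSucc_of_lt (hlt.trans_le hge)))

/-- Lemma 3, second part: if `ℓ_t ≥ p(ℓ₁,…,ℓ_{t-1})` then
`p(ℓ₁,…,ℓ_t) = p(ℓ₁,…,ℓ_{t-1})` (the `ℓ_i` need not be sorted). -/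
theorem pRamsey_eq_drop_last (t : ℕ) (ht : 3 ≤ t) (ℓ : Fin t → ℕ) (h2 : ∀ i, 2 ≤ ℓ i)
    (hge : pRamsey (t - 1) (fun i => ℓ (Fin.castLE (Nat.sub_le t 1) i)) ≤ ℓ ⟨t - 1, by omega⟩) :
    pRamsey t ℓ = pRamsey (t - 1) (fun i => ℓ (Fin.castLE (Nat.sub_le t 1) i)) := by
  obtain ⟨t, rfl⟩ : ∃ u, t = u + 1 := ⟨t - 1, by omega⟩
  exact pRamsey_succ_eq (by omega) ℓ hge
end

section
/- Let t ≥ 3 and 2 ≤ ℓ₁ ≤ ℓ₂ ≤ ... ≤ ℓ_t be integers with ℓ_t < p(ℓ₁,...,ℓ_{t−1}). Then p(ℓ₁,...,ℓ_t) ≥ s(ℓ₁,...,ℓ_t); that is, there exists a t-colouring of the complete graph on s(ℓ₁,...,ℓ_t) − 1 vertices such that for every j ∈ {1,...,t} there is no path on ℓ_j vertices avoiding colour j. -/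
/-- A bound for the first `u` colours passes to `t` colours, by merging the extra colours into
the first one. -/
theorem IsChromRamsey.of_castLE {u t n : ℕ} (hut : u ≤ t) (hu : 0 < u) {L : Fin t → ℕ}
    (h : IsChromRamsey u (fun i => L (Fin.castLE hut i)) n) : IsChromRamsey t L n := by
  intro c
  obtain ⟨i, P, hP, hc⟩ := h fun e => if hx : (c e : ℕ) < u then ⟨c e, hx⟩ else ⟨0, hu⟩
  refine ⟨Fin.castLE hut i, P, hP, fun k hk he => hc k hk ?_⟩
  simp [he]

theorem AvoidsPath.castLE {m n t ℓ : ℕ} (hmn : m ≤ n) {c : Sym2 (Fin n) → Fin t} {i : Fin t}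
    (h : AvoidsPath m t ℓ (fun e => c (e.map (Fin.castLE hmn))) i) : AvoidsPath n t ℓ c i := by
  obtain ⟨P, hP, hc⟩ := h
  refine ⟨fun k => Fin.castLE hmn (P k), (Fin.castLE_injective hmn).comp hP, fun k hk => ?_⟩
  simpa using hc k hk

theorem IsChromRamsey.mono {m n t : ℕ} (hmn : m ≤ n) {L : Fin t → ℕ}
    (h : IsChromRamsey t L m) : IsChromRamsey t L n := fun c =>
  (h fun e => c (e.map (Fin.castLE hmn))).imp fun _ hi => hi.castLE hmn

/-- With one extra colour whose path does not fit into `K_n`, a good colouring stays good. -/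
theorem exists_colouring_castLE {u n : ℕ} {L : Fin (u + 1) → ℕ} (hn : n < L (Fin.last u))
    (h : ¬ IsChromRamsey u (fun i => L i.castSucc) n) :
    ∃ c : Sym2 (Fin n) → Fin (u + 1), ∀ j, ¬ AvoidsPath n (u + 1) (L j) c j := by
  simp only [IsChromRamsey, not_forall, not_exists] at h
  obtain ⟨c, hc⟩ := h
  refine ⟨fun e => (c e).castSucc, fun j => Fin.lastCases ?_ (fun i => ?_) j⟩
  · rintro ⟨P, hP, -⟩
    have := Fintype.card_le_of_injective P hP
    simp only [Fintype.card_fin] at this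
    omega
  · rintro ⟨P, hP, hk⟩
    exact hc i ⟨P, hP, fun k h he => hk k h (congrArg Fin.castSucc he)⟩

/-- In a word of length `m` whose consecutive letters never have maximum `j`, letters `j` are
flanked by larger letters only. -/
theorem length_le_of_max_ne (a : ℕ → ℕ) (j m : ℕ)
    (h : ∀ k, k + 1 < m → max (a k) (a (k + 1)) ≠ j) :
    m ≤ 2 * Nat.count (fun k => j < a k) m + max 1 (Nat.count (fun k => a k < j) m) := by
  have key : ∀ k, k < m →
      let G := Nat.count (fun k => j < a k) (k + 1)
      let S := Nat.count (fun k => a k < j) (k + 1)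
      k + 1 ≤ 2 * G + max 1 S ∧ (a k < j → k + 1 ≤ 2 * G + S) ∧
        (j < a k → k + 1 + min 1 S ≤ 2 * G + S) := by
    intro k
    induction k with
    | zero =>
      intro _
      simp only [Nat.count_succ, Nat.count_zero]
      split_ifs <;> omega
    | succ k ih =>
      intro hk
      have h1 := h k hk
      have h2 := ih (by omega)
      rw [Nat.count_succ, Nat.count_succ _ (k + 1)]
      generalize Nat.count (fun k => j < a k) (k + 1) = G at *
      generalize Nat.count (fun k => a k < j) (k + 1) = S at *
      dsimp only at *
      split_ifs <;> omega
  rcases m with _ | m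
  · simp
  · exact (key m (by omega)).1

/-- The colouring in which the vertices `v` with `T (j + 1) ≤ v < T j` form class `j`, and an edge
gets the larger of the classes of its ends. -/
theorem exists_colouring_of_thresholds {n t : ℕ} (ht : 0 < t) (L : Fin t → ℕ) (T : ℕ → ℕ)
    (hT : Antitone T) (hTt : T t = 0)
    (hL : ∀ j : Fin t, 2 * T (j + 1) + max 1 (n - T j) < L j) :
    ∃ c : Sym2 (Fin n) → Fin t, ∀ j, ¬ AvoidsPath n t (L j) c j := by
  have hex : ∀ v : ℕ, ∃ j, T (j + 1) ≤ v := fun v =>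
    ⟨t - 1, by rw [Nat.sub_add_cancel ht, hTt]; exact Nat.zero_le v⟩
  let f : ℕ → ℕ := fun v => Nat.find (hex v)
  have hft : ∀ v, f v < t := fun v => by
    have : f v ≤ t - 1 := Nat.find_min' (hex v) (by simp [Nat.sub_add_cancel ht, hTt])
    omega
  have hgt : ∀ v j, j < f v → v < T (j + 1) := fun v j h => not_le.1 (Nat.find_min (hex v) h)
  have hlt : ∀ v j, f v < j → T j ≤ v := fun v j h => (hT h).trans (Nat.find_spec (hex v))
  let F : Fin n → Fin t := fun v => ⟨f v, hft v⟩
  refine ⟨Sym2.lift ⟨fun u v => max (F u) (F v), fun u v => max_comm _ _⟩, fun j => ?_⟩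
  rintro ⟨P, hP, hc⟩
  let Q : ℕ → ℕ := fun k => if h : k < L j then P ⟨k, h⟩ else 0
  have hQ : ∀ k (h : k < L j), Q k = P ⟨k, h⟩ := fun k h => dif_pos h
  have hQinj : ∀ k < L j, ∀ l < L j, Q k = Q l → k = l := fun k hk l hl he => by
    rw [hQ k hk, hQ l hl] at he
    simpa using hP (Fin.ext he)
  have hlen := length_le_of_max_ne (fun k => f (Q k)) j (L j) fun k hk he => hc k hk <| by
    apply Fin.ext
    rw [← he]
    simp [hQ k (by omega), hQ (k + 1) hk, F, Fin.coe_max]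
  have hG : Nat.count (fun k => (j : ℕ) < f (Q k)) (L j) ≤ T (j + 1) := by
    rw [Nat.count_eq_card_filter_range, ← Finset.card_range (T (j + 1))]
    refine Finset.card_le_card_of_injOn Q (fun k hk => ?_) (fun k hk l hl => ?_)
    · simp only [Finset.coe_filter, Finset.mem_range, Set.mem_ofPred_eq, Finset.coe_range,
        Set.mem_Iio] at hk ⊢
      exact hgt _ _ hk.2
    · simp only [Finset.coe_filter, Finset.mem_range, Set.mem_ofPred_eq] at hk hl
      exact hQinj k hk.1 l hl.1
  have hS : Nat.count (fun k => f (Q k) < j) (L j) ≤ n - T j := by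
    rw [Nat.count_eq_card_filter_range, ← Nat.card_Ico]
    refine Finset.card_le_card_of_injOn Q (fun k hk => ?_) (fun k hk l hl => ?_)
    · simp only [Finset.coe_filter, Finset.mem_range, Set.mem_ofPred_eq, Finset.coe_Ico,
        Set.mem_Ico] at hk ⊢
      exact ⟨hlt _ _ hk.2, by rw [hQ k hk.1]; exact (P ⟨k, hk.1⟩).isLt⟩
    · simp only [Finset.coe_filter, Finset.mem_range, Set.mem_ofPred_eq] at hk hl
      exact hQinj k hk.1 l hl.1
  have := hL j
  omega

/-- The block colouring has no forbidden path as long as all `L i` are smaller than `s` and the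
blocks of positive index leave enough room for the block of index `0`. -/
theorem exists_colouring_of_sum_le {u s : ℕ} (L : Fin (u + 1) → ℕ) (h2 : 2 ≤ L 0)
    (hLs : ∀ i, L i < s)
    (hs : (2 ^ (u + 1) - 2) * s ≤ (∑ i : Fin (u + 1), 2 ^ (i : ℕ) * L i) - 2) :
    ∃ c : Sym2 (Fin (s - 1)) → Fin (u + 1), ∀ j, ¬ AvoidsPath (s - 1) (u + 1) (L j) c j := by
  let g : ℕ → ℕ := fun i => if h : i < u + 1 then s - L ⟨i, h⟩ else 0
  let X : ℕ → ℕ := fun j => ∑ i ∈ Finset.Ico j (u + 1), 2 ^ (i - j) * g i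
  have hX : ∀ j, j < u + 1 → X j = g j + 2 * X (j + 1) := fun j hj => by
    simp only [X]
    rw [Finset.sum_eq_sum_Ico_succ_bot hj, Finset.mul_sum]
    simp only [Nat.sub_self, pow_zero, one_mul, Nat.add_left_cancel_iff]
    refine Finset.sum_congr rfl fun i hi => ?_
    rw [Finset.mem_Ico] at hi
    rw [show i - j = i - (j + 1) + 1 by omega, pow_succ]
    ring
  have hX0 : ∀ j, u + 1 ≤ j → X j = 0 := fun j hj => by simp [X, Finset.Ico_eq_empty_of_le hj]
  have hstep : ∀ j, X (j + 1) ≤ X j := fun j => by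
    rcases lt_or_ge j (u + 1) with hj | hj
    · rw [hX j hj]; omega
    · rw [hX0 j hj, hX0 (j + 1) (by omega)]
  have hanti : Antitone X := antitone_nat_of_succ_le hstep
  have hsum : 2 * X 1 + 2 ≤ L 0 := by
    have h0 : X 0 + ∑ i : Fin (u + 1), 2 ^ (i : ℕ) * L i = (2 ^ (u + 1) - 1) * s := by
      have hX0' : X 0 = ∑ i : Fin (u + 1), 2 ^ (i : ℕ) * (s - L i) := by
        simp only [X, Nat.Ico_zero_eq_range, Nat.sub_zero, Finset.sum_range]
        exact Finset.sum_congr rfl fun i _ => by simp only [g, dif_pos i.isLt]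
      have hgeom : ∑ i ∈ Finset.range (u + 1), 2 ^ i = 2 ^ (u + 1) - 1 := by
        simpa using Nat.geomSum_eq le_rfl (u + 1)
      rw [hX0', ← Finset.sum_add_distrib, ← hgeom, Finset.sum_range, Finset.sum_mul]
      refine Finset.sum_congr rfl fun i _ => ?_
      rw [← mul_add, Nat.sub_add_cancel (hLs i).le]
    have h1 := hX 0 (by omega)
    have hg : g 0 = s - L 0 := by simp [g]
    have h3 := hLs 0
    have h4 : (2 ^ (u + 1) - 1) * s = (2 ^ (u + 1) - 2) * s + s := by
      have : 2 ≤ 2 ^ (u + 1) := by rw [pow_succ]; have := Nat.one_le_two_pow (n := u); omega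
      rw [show 2 ^ (u + 1) - 1 = 2 ^ (u + 1) - 2 + 1 by omega]
      ring
    have h5 : L 0 ≤ ∑ i : Fin (u + 1), 2 ^ (i : ℕ) * L i := by
      rw [Fin.sum_univ_succ]; simp
    simp only [zero_add] at h1
    omega
  have hs0 := hLs 0
  refine exists_colouring_of_thresholds (Nat.succ_pos u) L (fun j => if j = 0 then s - 1 else X j)
    (antitone_nat_of_succ_le fun j => ?_) (by simp [hX0]) fun j => ?_
  · rcases j with _ | j
    · simp only [zero_add, one_ne_zero, if_true, if_false]; omega
    · simpa using hstep (j + 1)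
  · rcases j with ⟨_ | j, hj⟩
    · simp only [zero_add, one_ne_zero, if_true, if_false, Fin.zero_eta]; omega
    · have h1 := hX (j + 1) hj
      have hg : g (j + 1) = s - L ⟨j + 1, hj⟩ := dif_pos hj
      have h3 := hLs ⟨j + 1, hj⟩
      have h4 : X (j + 1) ≤ X 1 := hanti (by omega)
      simp only [Nat.add_eq_zero_iff, one_ne_zero, and_false, if_false]
      omega

/-- Proposition 5 (the lower bound): if `ℓ_t < p(ℓ₁,…,ℓ_{t-1})` then
`p(ℓ₁,…,ℓ_t) ≥ s(ℓ₁,…,ℓ_t)`; that is, there is a `t`-colouring of the complete graph on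
`s(ℓ₁,…,ℓ_t) - 1` vertices with no colour-`j`-avoiding path on `ℓ_j` vertices, for all `j`. -/
theorem pRamsey_lower_bound (t : ℕ) (ht : 3 ≤ t) (ℓ : Fin t → ℕ)
    (hmono : Monotone ℓ) (h2 : 2 ≤ ℓ ⟨0, by omega⟩)
    (hlt : ℓ ⟨t - 1, by omega⟩ < pRamsey (t - 1) (fun i => ℓ (Fin.castLE (Nat.sub_le t 1) i))) :
    sVal t ℓ ≤ pRamsey t ℓ ∧
      ∃ c : Sym2 (Fin (sVal t ℓ - 1)) → Fin t,
        ∀ j : Fin t, ¬ AvoidsPath (sVal t ℓ - 1) t (ℓ j) c j := by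
  obtain ⟨u, rfl⟩ : ∃ u, t = u + 1 := ⟨t - 1, by omega⟩
  have hcol : ∃ c : Sym2 (Fin (sVal (u + 1) ℓ - 1)) → Fin (u + 1),
      ∀ j, ¬ AvoidsPath (sVal (u + 1) ℓ - 1) (u + 1) (ℓ j) c j := by
    have h2' : 2 ≤ ℓ (Fin.last u) := h2.trans (hmono (Fin.zero_le _))
    rcases le_or_gt (sVal (u + 1) ℓ) (ℓ (Fin.last u)) with h | h
    · refine exists_colouring_castLE (by omega) (Nat.notMem_of_lt_sInf (lt_trans ?_ hlt))
      change _ < ℓ (Fin.last u)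
      omega
    · exact exists_colouring_of_sum_le ℓ h2 (fun i => (hmono (Fin.le_last i)).trans_lt h)
        (Nat.mul_div_le _ _)
  refine ⟨?_, hcol⟩
  have hne : {n | IsChromRamsey u (fun i => ℓ (Fin.castLE (Nat.sub_le (u + 1) 1) i)) n}.Nonempty :=
    Nat.nonempty_of_pos_sInf (Nat.zero_lt_of_lt hlt)
  refine le_csInf (hne.mono fun n hn => hn.of_castLE _ (by omega)) fun n hn => ?_
  by_contra! hlt'
  obtain ⟨c, hc⟩ := hcol
  obtain ⟨i, hi⟩ := IsChromRamsey.mono (Nat.le_sub_one_of_lt hlt') hn c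
  exact hc i hi
end

section
/- Let t ≥ 3 and 2 ≤ ℓ₁ ≤ ℓ₂ ≤ ... ≤ ℓ_t be integers with ℓ₁ ≤ 3. Then p(ℓ₁,...,ℓ_t) ≤ s(ℓ₁,...,ℓ_t). -/
theorem avoidsPath_of_list {n t : ℕ} {c : Sym2 (Fin n) → Fin t} {i : Fin t} (l : List (Fin n))
    (hl : l.Nodup) (hc : l.IsChain fun a b => c s(a, b) ≠ i) : AvoidsPath n t l.length c i :=
  ⟨l.get, List.nodup_iff_injective_get.mp hl, fun k hk => List.isChain_iff_getElem.mp hc k hk⟩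

/-- A complete graph minus a matching contains a path on any number `m ≥ 3` of its vertices. -/
theorem exists_list_isChain_of_forall_or {α : Type*} [Fintype α] (R : α → α → Prop)
    (hsymm : ∀ a b, R a b → R b a)
    (h : ∀ a b c, a ≠ b → a ≠ c → b ≠ c → R a b ∨ R a c)
    (m : ℕ) (hm : 3 ≤ m) (hcard : m ≤ Fintype.card α) :
    ∃ l : List α, l.length = m ∧ l.Nodup ∧ l.IsChain R := by
  classical
  induction m, hm using Nat.le_induction with
  | base =>
    obtain ⟨a, b, c, hab, hac, hbc⟩ := Fintype.two_lt_card_iff.mp hcard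
    rcases h a b c hab hac hbc with h1 | h1
    · rcases h c a b hac.symm hbc.symm hab with h2 | h2
      · exact ⟨[c, a, b], by grind⟩
      · exact ⟨[a, b, c], by grind⟩
    · rcases h b a c hab.symm hbc hac with h2 | h2
      · exact ⟨[b, a, c], by grind⟩
      · exact ⟨[a, c, b], by grind⟩
  | succ m hm ih =>
    obtain ⟨l, hlen, hnd, hch⟩ := ih (by omega)
    obtain ⟨w, hw⟩ : ∃ w, w ∉ l := by
      by_contra! hall
      have := Finset.card_le_card (fun x _ => List.mem_toFinset.mpr (hall x) :
        (Finset.univ : Finset α) ⊆ l.toFinset)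
      have := List.toFinset_card_le l
      rw [Finset.card_univ] at *
      omega
    have hne : l ≠ [] := by grind
    have hends : l.head hne ≠ l.getLast hne := by
      rw [List.head_eq_getElem, List.getLast_eq_getElem]
      intro heq
      have := (hnd.getElem_inj_iff).mp heq
      omega
    rcases h w (l.head hne) (l.getLast hne) (by grind) (by grind) hends with h1 | h1
    · refine ⟨w :: l, by simp [hlen], by simp [hw, hnd], ?_⟩
      rw [List.isChain_cons]
      exact ⟨by simpa [List.head?_eq_some_head hne] using h1, hch⟩
    · refine ⟨l ++ [w], by simp [hlen], by grind, ?_⟩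
      rw [List.isChain_append]
      exact ⟨hch, by simp, by grind⟩

theorem le_sVal {k : ℕ} {ℓ : Fin (k + 1) → ℕ} (hmono : Monotone ℓ) (h2 : 2 ≤ ℓ 0)
    {i : Fin (k + 1)} (hi : (i : ℕ) = 1) : ℓ i ≤ sVal (k + 1) ℓ := by
  have hpow : 2 ^ 2 ≤ 2 ^ (k + 1) := Nat.pow_le_pow_right (by norm_num) (by omega)
  have hgeom : ∀ j : ℕ, ∑ i ∈ Finset.range j, 2 ^ (i + 1) + 2 = 2 ^ (j + 1) := by
    intro j
    induction j with
    | zero => rfl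
    | succ j ih =>
      rw [Finset.sum_range_succ, pow_succ 2 (j + 1)]
      omega
  have hsum : (∑ j : Fin k, 2 ^ ((j : ℕ) + 1)) * ℓ i
      ≤ ∑ j : Fin k, 2 ^ ((j : ℕ) + 1) * ℓ j.succ := by
    rw [Finset.sum_mul]
    exact Finset.sum_le_sum fun j _ =>
      Nat.mul_le_mul_left _ (hmono (Fin.le_def.mpr (by simp [hi])))
  rw [Fin.sum_univ_eq_sum_range (fun i => 2 ^ (i + 1)) k,
    Nat.eq_sub_of_add_eq (hgeom k)] at hsum
  rw [sVal, Nat.le_div_iff_mul_le (by omega), Fin.sum_univ_succ, mul_comm]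
  simp only [Fin.val_zero, pow_zero, one_mul, Fin.val_succ]
  omega

/-- Lemma 6: if `ℓ₁ ≤ 3` then `p(ℓ₁,…,ℓ_t) ≤ s(ℓ₁,…,ℓ_t)`. -/
theorem pRamsey_le_sVal_of_small (t : ℕ) (ht : 3 ≤ t) (ℓ : Fin t → ℕ)
    (hmono : Monotone ℓ) (h2 : 2 ≤ ℓ ⟨0, by omega⟩) (h3 : ℓ ⟨0, by omega⟩ ≤ 3) :
    pRamsey t ℓ ≤ sVal t ℓ := by
  refine Nat.sInf_le fun c => ?_
  have hn : ℓ ⟨1, by omega⟩ ≤ sVal t ℓ := by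
    obtain ⟨k, rfl⟩ : ∃ k, t = k + 1 := ⟨t - 1, by omega⟩
    exact le_sVal hmono h2 rfl
  have h01 : ℓ ⟨0, by omega⟩ ≤ ℓ ⟨1, by omega⟩ := hmono (by simp)
  have hcol : (⟨1, by omega⟩ : Fin t) ≠ ⟨0, by omega⟩ := by simp
  by_contra! hno
  have hno0 := hno ⟨0, by omega⟩
  refine hno ⟨1, by omega⟩ ?_
  obtain h | h : ℓ ⟨0, by omega⟩ = 2 ∨ ℓ ⟨0, by omega⟩ = 3 := by omega
  · refine ⟨Fin.castLE hn, Fin.castLE_injective hn, fun k hk hck => hno0 ?_⟩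
    rw [h]
    exact avoidsPath_of_list [Fin.castLE hn ⟨k, by omega⟩, Fin.castLE hn ⟨k + 1, hk⟩]
      (by simp) (List.isChain_pair.mpr (by rw [hck]; exact hcol))
  · obtain ⟨l, hlen, hnd, hch⟩ := exists_list_isChain_of_forall_or
      (fun a b => c s(a, b) ≠ ⟨1, by omega⟩) (fun a b hab => by rwa [Sym2.eq_swap])
      (fun a b d hab had hbd => by
        by_contra! hbad
        refine hno0 ?_
        rw [h]
        exact avoidsPath_of_list [b, a, d] (by simp [hab.symm, had, hbd])
          (by simp [Sym2.eq_swap (a := b), hbad.1, hbad.2]))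
      (ℓ ⟨1, by omega⟩) (by omega) (by simpa using hn)
    rw [← hlen]
    exact avoidsPath_of_list l hnd hch
end

section
/- Let t ≥ 3 and 2 ≤ ℓ₁ ≤ ℓ₂ ≤ ... ≤ ℓ_t be integers with ℓ_t < p(ℓ₁,...,ℓ_{t−1}). Then p(ℓ₁,...,ℓ_t) ≤ s(ℓ₁,...,ℓ_t); that is, every t-colouring of the complete graph on s(ℓ₁,...,ℓ_t) vertices contains, for some j ∈ {1,...,t}, a path on ℓ_j vertices avoiding colour j. -/
open Finset

section LongestPath

variable {V : Type*}

/-- `l` lists the vertices of a path in the graph induced by the relation `r` on `A`. -/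
def IsPathIn (r : V → V → Prop) (A : Finset V) (l : List V) : Prop :=
  l.Nodup ∧ (∀ v ∈ l, v ∈ A) ∧ l.IsChain r

open Classical in
/-- The number of vertices of a longest path in the graph induced by `r` on `A`. -/
noncomputable def longestPath (r : V → V → Prop) (A : Finset V) : ℕ :=
  Nat.findGreatest (fun k => ∃ l, IsPathIn r A l ∧ l.length = k) #A

lemma IsPathIn.length_le_card {r : V → V → Prop} {A : Finset V} {l : List V}
    (h : IsPathIn r A l) : l.length ≤ #A := by
  classical
  rw [← List.toFinset_card_of_nodup h.1]
  exact card_le_card fun v hv => h.2.1 v (List.mem_toFinset.1 hv)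

lemma IsPathIn.length_le {r : V → V → Prop} {A : Finset V} {l : List V}
    (h : IsPathIn r A l) : l.length ≤ longestPath r A := by
  classical
  exact Nat.le_findGreatest h.length_le_card ⟨l, h, rfl⟩

lemma longestPath_le_card (r : V → V → Prop) (A : Finset V) : longestPath r A ≤ #A := by
  classical
  exact Nat.findGreatest_le _

lemma exists_isPathIn_length_eq (r : V → V → Prop) (A : Finset V) :
    ∃ l, IsPathIn r A l ∧ l.length = longestPath r A := by
  classical
  exact Nat.findGreatest_spec (P := fun k => ∃ l, IsPathIn r A l ∧ l.length = k) (Nat.zero_le _)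
    ⟨[], by simp [IsPathIn], rfl⟩

lemma longestPath_mono (r : V → V → Prop) {A B : Finset V} (h : A ⊆ B) :
    longestPath r A ≤ longestPath r B := by
  obtain ⟨l, hl, hlen⟩ := exists_isPathIn_length_eq r A
  rw [← hlen]
  exact IsPathIn.length_le ⟨hl.1, fun v hv => h (hl.2.1 v hv), hl.2.2⟩

lemma longestPath_pos (r : V → V → Prop) {A : Finset V} (h : A.Nonempty) :
    0 < longestPath r A := by
  obtain ⟨x, hx⟩ := h
  exact IsPathIn.length_le (l := [x]) (by simpa [IsPathIn] using hx)

lemma IsPathIn.cons {r : V → V → Prop} {A : Finset V} {v w : V} {l : List V}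
    (h : IsPathIn r A (w :: l)) (hv : v ∈ A) (hvl : v ∉ w :: l) (hr : r v w) :
    IsPathIn r A (v :: w :: l) := by
  refine ⟨List.nodup_cons.2 ⟨hvl, h.1⟩, ?_, List.isChain_cons_cons.2 ⟨hr, h.2.2⟩⟩
  simp only [List.forall_mem_cons]
  exact ⟨hv, by simpa using h.2.1⟩

lemma IsPathIn.reverse {r : V → V → Prop} (hr : ∀ a b, r a b → r b a) {A : Finset V}
    {l : List V} (h : IsPathIn r A l) : IsPathIn r A l.reverse := by
  refine ⟨List.nodup_reverse.2 h.1, fun v hv => h.2.1 v (List.mem_reverse.1 hv), ?_⟩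
  rw [List.isChain_reverse]
  exact h.2.2.imp fun a b => hr a b

/-- Pósa rotation: reversing an initial segment of a path. -/
lemma IsPathIn.rotate {r : V → V → Prop} (hr : ∀ a b, r a b → r b a) {A : Finset V}
    {x y : V} {a b : List V} (h : IsPathIn r A (x :: a ++ y :: b)) (hxy : r x y) :
    IsPathIn r A ((x :: a).reverse ++ y :: b) := by
  have hperm : ((x :: a).reverse ++ y :: b).Perm (x :: a ++ y :: b) :=
    (List.reverse_perm _).append_right _
  refine ⟨hperm.nodup_iff.2 h.1, fun v hv => h.2.1 v (hperm.mem_iff.1 hv), ?_⟩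
  have hc := List.isChain_append.1 h.2.2
  refine List.isChain_append.2 ⟨?_, hc.2.1, ?_⟩
  · rw [List.isChain_reverse]
    exact hc.1.imp fun a b => hr a b
  · simpa using hxy

variable [DecidableEq V]

/-- Distinct vertices after the first one of a path have distinct predecessors. -/
lemma card_le_card_of_predecessors {w : V} {l : List V} (hl : (w :: l).Nodup) {F Z : Finset V}
    (hF : ∀ y ∈ F, y ∈ l) (hZ : ∀ a z y b, y ∈ F → w :: l = a ++ z :: y :: b → z ∈ Z) :
    #F ≤ #Z := by
  have key : ∀ y ∈ F, ∃ z a b, w :: l = a ++ z :: y :: b := by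
    intro y hy
    obtain ⟨s, b, hs⟩ := List.append_of_mem (hF y hy)
    rcases List.eq_nil_or_concat (w :: s) with h | ⟨a, z, h⟩
    · simp at h
    · refine ⟨z, a, b, ?_⟩
      rw [hs, ← List.cons_append, h]
      simp
  choose! f a b hf using key
  refine card_le_card_of_injOn f (fun y hy => hZ _ _ _ _ hy (hf y hy)) ?_
  intro y hy y' hy' hyy
  have h1 := hf y hy
  have h2 := hf y' hy'
  rw [← hyy] at h2
  have n1 := hl
  rw [h1] at n1
  have n2 := hl
  rw [h2] at n2
  have m1 : f y ∉ a y := fun hm => (List.disjoint_of_nodup_append n1) hm (by simp)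
  have m2 : f y ∉ a y' := fun hm => (List.disjoint_of_nodup_append n2) hm (by simp)
  have e : (w :: l).idxOf (f y) = (a y).length := by
    rw [h1, List.idxOf_append_of_notMem m1]; simp
  have e' : (w :: l).idxOf (f y) = (a y').length := by
    rw [h2, List.idxOf_append_of_notMem m2]; simp
  have := List.append_inj (h1.symm.trans h2) (e.symm.trans e')
  simpa using (List.cons.inj (List.cons.inj this.2).2).1

/-- A vertex whose degree is at least every codegree can be deleted only at the cost of
shortening the longest path by two, unless there is a Hamiltonian path. -/
lemma longestPath_erase_add_two_le {r : V → V → Prop} [DecidableRel r]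
    (hr : ∀ a b, r a b → r b a)
    {A : Finset V} {x : V} (hx : x ∈ A) (hA : longestPath r A < #A)
    (hmax : ∀ v ∈ A, #{y ∈ A | y ≠ v ∧ ¬ r v y} ≤ #{y ∈ A | y ≠ x ∧ r x y}) :
    longestPath r (A.erase x) + 2 ≤ longestPath r A := by
  by_contra! hlt
  have hbound : ∀ l, IsPathIn r A l → l.length < longestPath r (A.erase x) + 2 :=
    fun l hl => hl.length_le.trans_lt hlt
  -- no longest path starts at `x`
  have hstart : ∀ l, IsPathIn r A (x :: l) → l.length ≠ longestPath r (A.erase x) := by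
    intro l hl hlen
    have hcard : #(x :: l).toFinset < #A := by
      rw [List.toFinset_card_of_nodup hl.1]
      exact hl.length_le.trans_lt hA
    obtain ⟨u, huA, hu⟩ := exists_mem_notMem_of_card_lt_card hcard
    rw [List.mem_toFinset] at hu
    have hnot : ∀ z l', IsPathIn r A (z :: l') → (z :: l').Perm (x :: l) → ¬ r u z := by
      intro z l' hz hp hrz
      have h1 := hbound _ (hz.cons huA (fun h => hu (hp.mem_iff.1 h)) hrz)
      have h2 := hp.length_eq
      simp only [List.length_cons] at h1 h2
      omega
    have hlast : (x :: l).getLast (by simp) ∈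
        ({y ∈ A | y ≠ u ∧ ¬ r u y} : Finset V) := by
      have hm := List.getLast_mem (l := x :: l) (by simp)
      refine mem_filter.2 ⟨hl.2.1 _ hm, fun h => hu (h ▸ hm), ?_⟩
      have hrev : (x :: l).reverse =
          (x :: l).getLast (by simp) :: ((x :: l).dropLast).reverse := by
        conv_lhs => rw [← List.dropLast_append_getLast (l := x :: l) (by simp)]
        simp
      refine hnot _ ((x :: l).dropLast).reverse ?_ ?_
      · rw [← hrev]; exact hl.reverse hr
      · rw [← hrev]; exact List.reverse_perm _
    have hle : #{y ∈ A | y ≠ x ∧ r x y} ≤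
        #(({y ∈ A | y ≠ u ∧ ¬ r u y} : Finset V).erase ((x :: l).getLast (by simp))) := by
      refine card_le_card_of_predecessors hl.1 ?_ ?_
      · intro y hy
        obtain ⟨hyA, hyx, hxy⟩ := mem_filter.1 hy
        by_contra hyl
        have := hbound _ (hl.cons hyA (by simp [hyx, hyl]) (hr _ _ hxy))
        simp only [List.length_cons] at this
        omega
      · intro a z y b hy he
        obtain ⟨hyA, hyx, hxy⟩ := mem_filter.1 hy
        have hz : z ∈ x :: l := by rw [he]; simp
        have hnd := hl.1
        rw [he] at hnd
        refine mem_erase.2 ⟨?_, mem_filter.2 ⟨hl.2.1 _ hz, fun h => hu (h ▸ hz), ?_⟩⟩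
        · have hg : (x :: l).getLast (by simp) ∈ y :: b := by
            simp only [he]
            rw [List.getLast_append_of_ne_nil _ (by simp), List.getLast_cons (by simp)]
            exact List.getLast_mem _
          intro h
          rw [← h] at hg
          exact (List.nodup_cons.1 (List.nodup_append.1 hnd).2.1).1 hg
        · have hcat : a ++ z :: y :: b = (a ++ [z]) ++ y :: b := by simp
          obtain ⟨s, hs⟩ : ∃ s, a ++ [z] = x :: s := by
            cases a with
            | nil => exact ⟨[], by simpa using (List.cons.inj he).1.symm⟩
            | cons w a => exact ⟨a ++ [z], by simpa using (List.cons.inj he).1.symm⟩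
          have hfull : x :: l = x :: s ++ y :: b := by rw [he, hcat, hs]
          have hrot := (hfull ▸ hl).rotate hr hxy
          have hp : ((x :: s).reverse ++ y :: b).Perm (x :: l) := by
            rw [hfull]; exact (List.reverse_perm _).append_right _
          have hform : (x :: s).reverse ++ y :: b = z :: (a.reverse ++ y :: b) := by
            rw [← hs]; simp
          rw [hform] at hrot hp
          exact hnot _ _ hrot hp
    rw [card_erase_of_mem hlast] at hle
    have h1 := hmax u huA
    have h2 := card_pos.2 ⟨_, hlast⟩
    omega
  -- a longest path avoiding `x`, listed from its last vertex
  obtain ⟨l, hl, hlen⟩ := exists_isPathIn_length_eq r (A.erase x)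
  have hlA : IsPathIn r A l := ⟨hl.1, fun v hv => mem_of_mem_erase (hl.2.1 v hv), hl.2.2⟩
  have hxl : ∀ l' : List V, l'.Perm l → x ∉ l' := fun l' hp h =>
    notMem_erase x A (hl.2.1 x (hp.mem_iff.1 h))
  have hend : ∀ z l', IsPathIn r A (z :: l') → (z :: l').Perm l → ¬ r x z := by
    intro z l' hz hp hrz
    exact hstart _ (hz.cons hx (hxl _ hp) hrz) (by rw [hp.length_eq, hlen])
  obtain ⟨p, t, hpt⟩ : ∃ p t, l.reverse = p :: t := by
    refine List.exists_cons_of_ne_nil ?_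
    rw [Ne, List.reverse_eq_nil_iff]
    rintro rfl
    have h0 : ¬ (A.erase x).Nonempty := fun h => (longestPath_pos r h).ne hlen
    have h1 := longestPath_pos r ⟨x, hx⟩
    rw [not_nonempty_iff_eq_empty, ← card_eq_zero, card_erase_of_mem hx] at h0
    omega
  have hptl : (p :: t).Perm l := hpt ▸ List.reverse_perm l
  have hpl : p ∈ l := hptl.mem_iff.1 (by simp)
  have hpath : IsPathIn r (A.erase x) (p :: t) := hpt ▸ hl.reverse hr
  have hpathA : IsPathIn r A (p :: t) := hpt ▸ hlA.reverse hr
  let F : Finset V := {y ∈ A | y ≠ x ∧ r x y}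
  let Z : Finset V := {z ∈ l.toFinset | z ≠ p ∧ ¬ r p z}
  have hFZ : #{y ∈ F | y ∈ l} ≤ #Z := by
    obtain ⟨w, l', rfl⟩ := List.exists_cons_of_ne_nil (List.ne_nil_of_mem hpl)
    refine card_le_card_of_predecessors hl.1 ?_ ?_
    · intro y hy
      obtain ⟨hyF, hyl⟩ := mem_filter.1 hy
      rcases List.mem_cons.1 hyl with rfl | h
      · exact absurd (mem_filter.1 hyF).2.2 (hend _ _ hlA (List.Perm.refl _))
      · exact h
    · intro a z y b hy he
      obtain ⟨hyF, -⟩ := mem_filter.1 hy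
      obtain ⟨s, hs⟩ : ∃ s, b.reverse ++ [y] = p :: s := by
        rw [he] at hpt
        cases hb : b.reverse with
        | nil => exact ⟨[], by simp_all⟩
        | cons v b' => exact ⟨b' ++ [y], by simp_all⟩
      have hform : p :: t = p :: s ++ z :: a.reverse := by
        rw [← hpt, he, ← hs]; simp
      have hnd := hpathA.1
      rw [hform] at hnd
      refine mem_filter.2 ⟨by rw [he]; simp, ?_, fun hpz => ?_⟩
      · rintro rfl
        simp at hnd
      · have hrot := (hform ▸ hpathA).rotate hr hpz
        have hp : ((p :: s).reverse ++ z :: a.reverse).Perm (w :: l') := by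
          refine List.Perm.trans ?_ hptl
          rw [hform]
          exact (List.reverse_perm _).append_right _
        have hform' : (p :: s).reverse ++ z :: a.reverse = y :: (b ++ z :: a.reverse) := by
          rw [← hs]; simp
        rw [hform'] at hrot hp
        exact hend _ _ hrot hp (mem_filter.1 hyF).2.2
  have hrest : #{y ∈ F | y ∉ l} < #(A \ l.toFinset) := by
    refine card_lt_card (ssubset_iff_of_subset ?_ |>.2 ⟨x, ?_, ?_⟩)
    · intro y hy
      simp only [F, mem_filter, mem_sdiff, List.mem_toFinset] at hy ⊢
      exact ⟨hy.1.1, hy.2⟩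
    · simpa using ⟨hx, hxl l (List.Perm.refl _)⟩
    · simp [F]
  have hsub : Z ∪ A \ l.toFinset ⊆ {y ∈ A | y ≠ p ∧ ¬ r p y} := by
    intro z hz
    rcases mem_union.1 hz with hz | hz
    · obtain ⟨h1, h2⟩ := mem_filter.1 hz
      exact mem_filter.2 ⟨hlA.2.1 z (List.mem_toFinset.1 h1), h2⟩
    · rw [mem_sdiff, List.mem_toFinset] at hz
      refine mem_filter.2 ⟨hz.1, fun h => hz.2 (h ▸ hpl), fun hpz => ?_⟩
      by_cases hzx : z = x
      · exact hend p t hpathA hptl (hr _ _ (hzx ▸ hpz))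
      · have h1 := (hpath.cons (mem_erase.2 ⟨hzx, hz.1⟩)
          (fun h => hz.2 (hptl.mem_iff.1 h)) (hr _ _ hpz)).length_le
        have h2 := hptl.length_eq
        simp only [List.length_cons] at h1 h2
        omega
  have hdisj : Disjoint Z (A \ l.toFinset) :=
    disjoint_sdiff.mono_left (filter_subset _ _)
  have h1 := card_le_card hsub
  rw [card_union_of_disjoint hdisj] at h1
  have h2 := hmax p (hlA.2.1 p hpl)
  have h3 : #{y ∈ F | y ∈ l} + #{y ∈ F | y ∉ l} = #F := card_filter_add_card_filter_not _
  have h4 : #F = #{y ∈ A | y ≠ x ∧ r x y} := rfl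
  omega

/-- In an edge-coloured complete graph on `A`, the numbers of vertices missed by longest paths
avoiding the colours of `S`, weighted by powers of two in some order, add up to less than `#A`. -/
theorem exists_sum_two_pow_mul_deficiency_lt {κ : Type*} [DecidableEq κ] (c : Sym2 V → κ)
    (A : Finset V) (hA : A.Nonempty) (S : Finset κ) :
    ∃ σ : κ → ℕ, S.image σ = range #S ∧
      ∑ i ∈ S, 2 ^ σ i * (#A - longestPath (fun a b => c s(a, b) ≠ i) A) < #A := by
  induction hN : #A + #S using Nat.strong_induction_on generalizing A S with
  | _ N ih =>
  subst hN
  set m : κ → Finset V → ℕ := fun i B => longestPath (fun a b => c s(a, b) ≠ i) B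
  have hApos := card_pos.2 hA
  by_cases hham : ∃ i ∈ S, m i A = #A
  · obtain ⟨i, hi, hmi⟩ := hham
    have hcard := card_erase_add_one hi
    obtain ⟨σ, hσ, hsum⟩ := ih (#A + #(S.erase i)) (by omega) A hA (S.erase i) rfl
    have hσ' : ∀ k ∈ S.erase i, Function.update σ i #(S.erase i) k = σ k := fun k hk =>
      Function.update_of_ne (ne_of_mem_erase hk) _ _
    refine ⟨Function.update σ i #(S.erase i), ?_, ?_⟩
    · rw [← hcard, range_add_one, ← hσ]
      nth_rw 2 [← insert_erase hi]
      rw [image_insert, Function.update_self, image_congr hσ']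
    · rw [← add_sum_erase _ _ hi, sum_congr rfl fun k hk => by rw [hσ' k hk]]
      have : #A - longestPath (fun a b => c s(a, b) ≠ i) A = 0 := by
        rw [← hmi]; exact Nat.sub_self _
      rw [this]
      simpa using hsum
  push Not at hham
  have hlt : ∀ i ∈ S, m i A < #A := fun i hi =>
    lt_of_le_of_ne (longestPath_le_card _ _) (hham i hi)
  rcases S.eq_empty_or_nonempty with rfl | hS
  · exact ⟨fun _ => 0, by simp, by simpa using hApos⟩
  obtain ⟨⟨x, j⟩, hxj, hmax⟩ := exists_max_image (A ×ˢ S)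
    (fun q => #{y ∈ A | y ≠ q.1 ∧ c s(q.1, y) = q.2}) (hA.product hS)
  obtain ⟨hx, hj⟩ := mem_product.1 hxj
  have hcard : #(A.erase x) + 1 = #A := card_erase_add_one hx
  have hA' : (A.erase x).Nonempty := by
    have h1 := hlt j hj
    have h2 : 0 < m j A := longestPath_pos _ hA
    exact card_pos.1 (by omega)
  obtain ⟨σ, hσ, hsum⟩ := ih (#(A.erase x) + #S) (by omega) (A.erase x) hA' S rfl
  refine ⟨σ, hσ, ?_⟩
  have hstep : ∀ i ∈ S, i ≠ j → m i (A.erase x) + 2 ≤ m i A := by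
    intro i hi hij
    refine longestPath_erase_add_two_le (r := fun a b => c s(a, b) ≠ i) (fun a b h => by rwa [Sym2.eq_swap]) hx (hlt i hi) ?_
    intro v hv
    refine le_trans ?_ ((hmax (v, i) (mem_product.2 ⟨hv, hi⟩)).trans ?_)
    · exact card_le_card fun y hy => by simpa using hy
    · refine card_le_card fun y hy => ?_
      obtain ⟨h1, h2, h3⟩ := mem_filter.1 hy
      rw [mem_filter]
      exact ⟨h1, h2, fun h => hij (h.symm.trans h3)⟩
  have hinj : Set.InjOn σ S := by
    refine injOn_of_card_image_eq ?_
    rw [hσ, card_range]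
  have hpow : ∑ i ∈ S, 2 ^ σ i + 1 = 2 ^ #S := by
    rw [← sum_image (f := fun k => 2 ^ k) hinj, hσ, Nat.geomSum_eq le_rfl]
    simp [Nat.sub_add_cancel Nat.one_le_two_pow]
  have hσj : 2 * 2 ^ σ j ≤ 2 ^ #S := by
    have : σ j ∈ range #S := hσ ▸ mem_image_of_mem σ hj
    rw [← pow_succ']
    exact Nat.pow_le_pow_right (by norm_num) (mem_range.1 this)
  have hle : ∑ i ∈ S, 2 ^ σ i * (#A - m i A) + ∑ i ∈ S, 2 ^ σ i ≤
      ∑ i ∈ S, 2 ^ σ i * (#(A.erase x) - m i (A.erase x)) + 2 * 2 ^ σ j := by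
    have hjsum : 2 * 2 ^ σ j = ∑ i ∈ S, if i = j then 2 ^ σ i * 2 else 0 := by
      rw [sum_ite_eq' S j, if_pos hj, mul_comm]
    rw [hjsum, ← sum_add_distrib, ← sum_add_distrib]
    refine sum_le_sum fun i hi => ?_
    have h1 := hlt i hi
    have h2 : m i (A.erase x) ≤ m i A := longestPath_mono _ (erase_subset _ _)
    rw [← Nat.mul_succ]
    split_ifs with hij
    · rw [← mul_add]
      exact Nat.mul_le_mul_left _ (by omega)
    · have := hstep i hi hij
      exact Nat.mul_le_mul_left _ (by omega)
  change ∑ i ∈ S, 2 ^ σ i * (#A - m i A) < #A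
  change ∑ i ∈ S, 2 ^ σ i * (#(A.erase x) - m i (A.erase x)) < #(A.erase x) at hsum
  omega

end LongestPath

lemma avoidsPath_of_le_longestPath {n t k : ℕ} {c : Sym2 (Fin n) → Fin t} {i : Fin t}
    (h : k ≤ longestPath (fun a b => c s(a, b) ≠ i) univ) : AvoidsPath n t k c i := by
  obtain ⟨l, hl, hlen⟩ := exists_isPathIn_length_eq (fun a b => c s(a, b) ≠ i) univ
  rw [← hlen] at h
  refine ⟨fun a => l.get (a.castLE h), ?_, fun a ha => ?_⟩
  · exact (List.nodup_iff_injective_get.1 hl.1).comp (Fin.castLE_injective h)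
  · exact List.isChain_iff_getElem.1 hl.2.2 a (by omega)

/-- Theorem 7 (the upper bound): if `ℓ_t < p(ℓ₁,…,ℓ_{t-1})` then
`p(ℓ₁,…,ℓ_t) ≤ s(ℓ₁,…,ℓ_t)`; that is, every `t`-colouring of the complete graph on
`s(ℓ₁,…,ℓ_t)` vertices contains, for some `j`, a path on `ℓ_j` vertices avoiding colour `j`. -/
theorem pRamsey_upper_bound (t : ℕ) (ht : 3 ≤ t) (ℓ : Fin t → ℕ)
    (hmono : Monotone ℓ) (h2 : 2 ≤ ℓ ⟨0, by omega⟩)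
    (hlt : ℓ ⟨t - 1, by omega⟩ < pRamsey (t - 1) (fun i => ℓ (Fin.castLE (Nat.sub_le t 1) i))) :
    pRamsey t ℓ ≤ sVal t ℓ ∧ IsChromRamsey t ℓ (sVal t ℓ) := by
  suffices h : IsChromRamsey t ℓ (sVal t ℓ) from ⟨Nat.sInf_le h, h⟩
  set n := sVal t ℓ
  intro c
  by_contra! hno
  have hpow : (8 : ℕ) ≤ 2 ^ t := by
    calc (8 : ℕ) = 2 ^ 3 := by norm_num
      _ ≤ 2 ^ t := Nat.pow_le_pow_right (by norm_num) ht
  have hgeom : ∑ i : Fin t, 2 ^ (i : ℕ) + 1 = 2 ^ t := by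
    rw [Fin.sum_univ_eq_sum_range (fun k => 2 ^ k), Nat.geomSum_eq le_rfl]
    simp [Nat.sub_add_cancel Nat.one_le_two_pow]
  have hS : 2 * ∑ i : Fin t, 2 ^ (i : ℕ) ≤ ∑ i : Fin t, 2 ^ (i : ℕ) * ℓ i := by
    rw [mul_sum]
    refine sum_le_sum fun i _ => ?_
    rw [mul_comm]
    exact Nat.mul_le_mul_left _ (h2.trans (hmono (Fin.mk_le_of_le_val (Nat.zero_le _))))
  have hnpos : 0 < n := Nat.div_pos (by omega) (by omega)
  have hnlt : (∑ i : Fin t, 2 ^ (i : ℕ) * ℓ i) - 2 < (2 ^ t - 2) * (n + 1) :=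
    Nat.lt_mul_div_succ _ (by omega)
  have hne : (univ : Finset (Fin n)).Nonempty := ⟨⟨0, hnpos⟩, mem_univ _⟩
  obtain ⟨σ, hσ, hsum⟩ := exists_sum_two_pow_mul_deficiency_lt c univ hne univ
  have hσt : ∀ i, σ i < t := fun i => by
    have : σ i ∈ range #(univ : Finset (Fin t)) := hσ ▸ mem_image_of_mem σ (mem_univ i)
    simpa using this
  have hσinj : Function.Injective fun i => (⟨σ i, hσt i⟩ : Fin t) := by
    have hinj : Set.InjOn σ (univ : Finset (Fin t)) :=
      injOn_of_card_image_eq (by rw [hσ, card_range])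
    exact fun a b hab => hinj (by simp) (by simp) (Fin.mk.inj hab)
  let e : Equiv.Perm (Fin t) := Equiv.ofBijective _ (Finite.injective_iff_bijective.1 hσinj)
  have hanti : Antivary (fun i : Fin t => (2 : ℤ) ^ (i : ℕ)) fun i => (n : ℤ) + 1 - ℓ i := by
    refine Monotone.antivary (fun a b hab => ?_) fun a b hab => ?_
    · exact pow_le_pow_right₀ (by norm_num) hab
    · have := hmono hab
      lia
  have hrearr := hanti.sum_mul_le_sum_comp_perm_mul (σ := e)
  have hdef : ∑ i, (2 : ℤ) ^ (e i : ℕ) * ((n : ℤ) + 1 - ℓ i) < n := by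
    rw [card_univ, Fintype.card_fin] at hsum
    refine lt_of_le_of_lt ?_ (Int.ofNat_lt.2 hsum)
    push_cast
    refine sum_le_sum fun i _ => mul_le_mul_of_nonneg_left ?_ (by positivity)
    have := mt (avoidsPath_of_le_longestPath (c := c)) (hno i)
    omega
  have hlin : ∑ i : Fin t, (2 : ℤ) ^ (i : ℕ) * ((n : ℤ) + 1 - ℓ i) =
      (2 ^ t - 1) * (n + 1) - ∑ i : Fin t, (2 : ℤ) ^ (i : ℕ) * ℓ i := by
    have hg : ∑ i : Fin t, (2 : ℤ) ^ (i : ℕ) = 2 ^ t - 1 := by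
      rw [eq_sub_iff_add_eq]; exact_mod_cast hgeom
    simp only [mul_sub, sum_sub_distrib, ← sum_mul, hg]
  have hnlt' : (∑ i : Fin t, (2 : ℤ) ^ (i : ℕ) * ℓ i) - 2 < (2 ^ t - 2) * (n + 1) := by
    zify [show 2 ≤ ∑ i : Fin t, 2 ^ (i : ℕ) * ℓ i by omega, show 2 ≤ 2 ^ t by omega] at hnlt
    exact hnlt
  linarith
end

section
/- If 2 ≤ ℓ₁ ≤ ℓ₂ are integers, then p(ℓ₁, ℓ₂) = ℓ₂ + ⌊ℓ₁/2⌋ − 1; that is, ℓ₂ + ⌊ℓ₁/2⌋ − 1 is the least integer n such that every 2-colouring of K_n contains either a path on ℓ₁ vertices avoiding colour 1 or a path on ℓ₂ vertices avoiding colour 2. -/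
/-- A list of at least `2 * n + 2` distinct elements has two consecutive ones outside any given set
of size `n`. -/
theorem exists_free_consecutive {V : Type*} [DecidableEq V] (n : ℕ) :
    ∀ (I : List V) (U : Finset V), I.Nodup → U.card = n → 2 * n + 2 ≤ I.length →
      ∃ A u v C, I = A ++ u :: v :: C ∧ u ∉ U ∧ v ∉ U := by
  induction n with
  | zero =>
    intro I U _ hU hI
    match I, hI with
    | u :: v :: C, _ =>
      rw [Finset.card_eq_zero] at hU
      exact ⟨[], u, v, C, by simp, by simp [hU], by simp [hU]⟩
  | succ n ih =>
    intro I U hnd hU hI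
    match I, hnd, hI with
    | u :: v :: C, hnd, hI =>
      by_cases h : u ∉ U ∧ v ∉ U
      · exact ⟨[], u, v, C, by simp, h.1, h.2⟩
      · obtain ⟨w, hw, hwU⟩ : ∃ w, (w = u ∨ w = v) ∧ w ∈ U := by
          by_cases hu : u ∈ U
          · exact ⟨u, .inl rfl, hu⟩
          · exact ⟨v, .inr rfl, by tauto⟩
        have hwC : w ∉ C := by
          simp only [List.nodup_cons, List.mem_cons, not_or] at hnd
          rcases hw with rfl | rfl
          · exact hnd.1.2
          · exact hnd.2.1
        obtain ⟨A, a, b, D, hC, ha, hb⟩ := ih C (U.erase w)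
          (by simp only [List.nodup_cons] at hnd; exact hnd.2.2)
          (by rw [Finset.card_erase_of_mem hwU]; omega)
          (by simp only [List.length_cons] at hI; omega)
        refine ⟨u :: v :: A, a, b, D, by simp [hC], ?_, ?_⟩
        · intro h; exact ha (Finset.mem_erase.2 ⟨by rintro rfl; simp [hC] at hwC, h⟩)
        · intro h; exact hb (Finset.mem_erase.2 ⟨by rintro rfl; simp [hC] at hwC, h⟩)

/-- Two disjoint `R`-paths `l₁`, `l₂` with all ends outside `X`, on `2 * k - 2` vertices in total,
whose vertices lie in a set `T` of at most `k` vertices outside `X` or in a set `U` of `k - 2`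
vertices of `I`. -/
structure PathPair {V : Type*} (R : V → V → Prop) (X I : List V) (k : ℕ)
    (l₁ l₂ : List V) (T U : Finset V) : Prop where
  chain₁ : l₁.IsChain R
  chain₂ : l₂.IsChain R
  ne₁ : l₁ ≠ []
  ne₂ : l₂ ≠ []
  ends : ∀ l ∈ [l₁, l₂], (∀ a ∈ l.head?, a ∉ X) ∧ ∀ a ∈ l.getLast?, a ∉ X
  nodup : (l₁ ++ l₂).Nodup
  length : l₁.length + l₂.length + 2 = 2 * k
  cardT : T.card ≤ k
  cardU : U.card + 2 = k
  cover : ∀ v ∈ l₁ ++ l₂, v ∈ T ∨ v ∈ U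
  offT : ∀ v ∈ T, v ∉ X
  subU : ∀ v ∈ U, v ∈ I

namespace PathPair

variable {V : Type*} {R : V → V → Prop} {X I : List V} {k : ℕ} {l₁ l₂ : List V} {T U : Finset V}

theorem swap (h : PathPair R X I k l₁ l₂ T U) : PathPair R X I k l₂ l₁ T U where
  chain₁ := h.chain₂
  chain₂ := h.chain₁
  ne₁ := h.ne₂
  ne₂ := h.ne₁
  ends l hl := h.ends l (by simp at hl ⊢; tauto)
  nodup := List.nodup_append_comm.1 h.nodup
  length := by have := h.length; omega
  cardT := h.cardT
  cardU := h.cardU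
  cover v hv := h.cover v (by simp at hv ⊢; tauto)
  offT := h.offT
  subU := h.subU

theorem notMem_of_notMem (h : PathPair R X I k l₁ l₂ T U) (hI : ∀ v ∈ I, v ∈ X) {v : V}
    (hv : v ∉ X) (hT : v ∉ T) : v ∉ l₁ ++ l₂ := fun hm =>
  (h.cover v hm).elim hT fun hU => hv (hI v (h.subU v hU))

theorem notMem_of_mem (h : PathPair R X I k l₁ l₂ T U) {v : V}
    (hv : v ∈ X) (hU : v ∉ U) : v ∉ l₁ ++ l₂ := fun hm =>
  (h.cover v hm).elim (fun hT => h.offT v hT hv) hU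

theorem extend [DecidableEq V] (h : PathPair R X I k l₁ l₂ T U) (hI : ∀ v ∈ I, v ∈ X) {x y : V}
    (hy : y ∉ X) (hyT : y ∉ T) (hx : x ∈ I) (hxU : x ∉ U) (hyx : R y x)
    (hxl : ∀ a ∈ l₁.head?, R x a) :
    PathPair R X I (k + 1) (y :: x :: l₁) l₂ (insert y T) (insert x U) where
  chain₁ := by
    have := h.chain₁
    cases l₁ <;> simp_all
  chain₂ := h.chain₂
  ne₁ := by simp
  ne₂ := h.ne₂
  ends := by
    have h₁ := h.ends l₁ (by simp)
    have h₂ := h.ends l₂ (by simp)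
    have := h.ne₁
    obtain ⟨a, l, rfl⟩ := List.exists_cons_of_ne_nil this
    simp_all
  nodup := by
    have h₁ := h.notMem_of_notMem hI hy hyT
    have h₂ := h.notMem_of_mem (hI x hx) hxU
    have h₃ : y ≠ x := by rintro rfl; exact hy (hI _ hx)
    have := h.nodup
    simp only [List.cons_append, List.nodup_cons, List.mem_cons, not_or]
    exact ⟨⟨h₃, h₁⟩, h₂, this⟩
  length := by have := h.length; simp only [List.length_cons]; omega
  cardT := (Finset.card_insert_le _ _).trans (by have := h.cardT; omega)
  cardU := by rw [Finset.card_insert_of_notMem hxU]; have := h.cardU; omega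
  cover v hv := by
    have := h.cover v
    simp only [List.cons_append, List.mem_cons, Finset.mem_insert] at hv ⊢
    tauto
  offT v hv := by
    rcases Finset.mem_insert.1 hv with rfl | hv
    · exact hy
    · exact h.offT v hv
  subU v hv := by
    rcases Finset.mem_insert.1 hv with rfl | hv
    · exact hx
    · exact h.subU v hv

theorem isChain_join (h : PathPair R X I k l₁ l₂ T U) (hR : ∀ u v, R u v → R v u) {x : V}
    (h₁ : ∀ a ∈ l₁.head?, R x a) (h₂ : ∀ a ∈ l₂.head?, R x a) :
    (l₁.reverse ++ x :: l₂).IsChain R := by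
  refine List.isChain_append.2 ⟨?_, ?_, ?_⟩
  · rw [List.isChain_reverse]
    exact h.chain₁.imp fun _ _ => hR _ _
  · exact List.isChain_cons.2 ⟨h₂, h.chain₂⟩
  · intro a ha b hb
    simp only [List.head?_cons, Option.mem_def, Option.some.injEq] at hb
    subst hb
    exact hR _ _ (h₁ a (by simpa using ha))

theorem nodup_join (h : PathPair R X I k l₁ l₂ T U) {x : V} (hx : x ∉ l₁ ++ l₂) :
    (l₁.reverse ++ x :: l₂).Nodup := by
  have := h.nodup
  simp only [List.nodup_append', List.nodup_cons, List.mem_append, not_or, List.nodup_reverse,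
    List.disjoint_cons_right, List.mem_reverse, List.disjoint_reverse_left] at this hx ⊢
  tauto

theorem join [DecidableEq V] (h : PathPair R X I k l₁ l₂ T U) (hR : ∀ u v, R u v → R v u)
    (hI : ∀ v ∈ I, v ∈ X) {x y : V}
    (hy : y ∉ X) (hyT : y ∉ T) (hx : x ∈ I) (hxU : x ∉ U)
    (h₁ : ∀ a ∈ l₁.head?, R x a) (h₂ : ∀ a ∈ l₂.head?, R x a) :
    PathPair R X I (k + 1) [y] (l₁.reverse ++ x :: l₂) (insert y T) (insert x U) where
  chain₁ := by simp
  chain₂ := h.isChain_join hR h₁ h₂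
  ne₁ := by simp
  ne₂ := by simp
  ends := by
    have h₁ := h.ends l₁ (by simp)
    have h₂ := h.ends l₂ (by simp)
    have n₁ := h.ne₁
    have n₂ := h.ne₂
    obtain ⟨a, l, rfl⟩ := List.exists_cons_of_ne_nil n₂
    obtain ⟨l', b, rfl⟩ := (List.eq_nil_or_concat' l₁).resolve_left n₁
    simp_all [List.getLast?_cons]
  nodup := by
    rw [List.singleton_append, List.nodup_cons]
    refine ⟨fun hm => ?_, h.nodup_join (h.notMem_of_mem (hI x hx) hxU)⟩
    have h₁ := h.notMem_of_notMem hI hy hyT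
    have h₃ : y ≠ x := by rintro rfl; exact hy (hI _ hx)
    simp only [List.mem_append, List.mem_reverse, List.mem_cons] at hm h₁
    tauto
  length := by have := h.length; simp; omega
  cardT := (Finset.card_insert_le _ _).trans (by have := h.cardT; omega)
  cardU := by rw [Finset.card_insert_of_notMem hxU]; have := h.cardU; omega
  cover v hv := by
    have := h.cover v
    simp only [List.mem_append, List.mem_reverse, List.mem_cons, Finset.mem_insert,
      List.not_mem_nil] at this hv ⊢
    tauto
  offT v hv := by
    rcases Finset.mem_insert.1 hv with rfl | hv
    · exact hy
    · exact h.offT v hv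
  subU v hv := by
    rcases Finset.mem_insert.1 hv with rfl | hv
    · exact hx
    · exact h.subU v hv

end PathPair

theorem exists_notMem_list_finset {V : Type*} [Fintype V] [DecidableEq V] (X : List V)
    (T : Finset V) (h : X.length + T.card < Fintype.card V) : ∃ y, y ∉ X ∧ y ∉ T := by
  by_contra! hc
  have : (Finset.univ : Finset V) ⊆ X.toFinset ∪ T := by
    intro y _
    by_cases hy : y ∈ X
    · simp [hy]
    · simp [hc y hy]
  have h₁ := Finset.card_le_card this
  have h₂ := Finset.card_union_le X.toFinset T
  have h₃ := X.toFinset_card_le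
  rw [Finset.card_univ] at h₁
  omega

theorem exists_pathPair {V : Type*} [Fintype V] [DecidableEq V] {R : V → V → Prop}
    (hR : ∀ u v, R u v → R v u) {X I : List V} (hnd : I.Nodup) (hI : ∀ v ∈ I, v ∈ X)
    (hpair : ∀ A u v C, I = A ++ u :: v :: C → ∀ y ∉ X, R y u ∨ R y v) {r : ℕ} (hr : 2 ≤ r)
    (hIr : 2 * r ≤ I.length + 3) (hV : X.length + r ≤ Fintype.card V) :
    ∃ l₁ l₂ T U, PathPair R X I r l₁ l₂ T U := by
  induction r, hr using Nat.le_induction with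
  | base =>
    obtain ⟨y, hy, -⟩ := exists_notMem_list_finset X ∅ (by simp; omega)
    obtain ⟨z, hz, hzy⟩ := exists_notMem_list_finset X {y} (by simp; omega)
    have hzy : z ≠ y := by simpa using hzy
    exact ⟨[y], [z], {y, z}, ∅, by simp, by simp, by simp, by simp, by simp [hy, hz],
      by simp [hzy.symm], by simp, Finset.card_le_two, by simp, by simp, by simp [hy, hz],
      by simp⟩
  | succ k hk ih =>
    obtain ⟨l₁, l₂, T, U, h⟩ := ih (by omega) (by omega)
    have hT := h.cardT
    have hU := h.cardU
    obtain ⟨y, hy, hyT⟩ := exists_notMem_list_finset X T (by omega)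
    obtain ⟨A, u, v, C, hA, hu, hv⟩ := exists_free_consecutive U.card I U hnd rfl (by omega)
    obtain ⟨a, ha⟩ : ∃ a, l₁.head? = some a := ⟨_, List.head?_eq_some_head h.ne₁⟩
    obtain ⟨b, hb⟩ : ∃ b, l₂.head? = some b := ⟨_, List.head?_eq_some_head h.ne₂⟩
    have haX : a ∉ X := (h.ends l₁ (by simp)).1 a ha
    have hbX : b ∉ X := (h.ends l₂ (by simp)).1 b hb
    have key : ∃ x ∈ I, x ∉ U ∧ (R y x ∧ R a x ∨ R y x ∧ R b x ∨ R a x ∧ R b x) := by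
      have h₁ := hpair A u v C hA y hy
      have h₂ := hpair A u v C hA a haX
      have h₃ := hpair A u v C hA b hbX
      by_cases hc : R y u ∧ R a u ∨ R y u ∧ R b u ∨ R a u ∧ R b u
      · exact ⟨u, by simp [hA], hu, hc⟩
      · exact ⟨v, by simp [hA], hv, by tauto⟩
    obtain ⟨x, hx, hxU, ⟨h₁, h₂⟩ | ⟨h₁, h₂⟩ | ⟨h₁, h₂⟩⟩ := key
    · exact ⟨_, _, _, _, h.extend hI hy hyT hx hxU h₁ (by simpa [ha] using hR _ _ h₂)⟩
    · exact ⟨_, _, _, _, h.swap.extend hI hy hyT hx hxU h₁ (by simpa [hb] using hR _ _ h₂)⟩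
    · exact ⟨_, _, _, _, h.join hR hI hy hyT hx hxU (by simpa [ha] using hR _ _ h₁)
        (by simpa [hb] using hR _ _ h₂)⟩

/-- If a longest `B`-path has `m` vertices and leaves at least `ℓ / 2` vertices uncovered, where
`ℓ ≤ m + 1`, then there is an `R`-path on `ℓ` vertices. -/
theorem exists_path_of_longest {V : Type*} [Fintype V] {R B : V → V → Prop}
    (hR : ∀ u v, R u v → R v u) (hB : ∀ u v, B u v → B v u) (hRB : ∀ u v, R u v ∨ B u v)
    {X : List V} (hX : X.Nodup) (hXB : X.IsChain B)
    (hmax : ∀ l : List V, l.Nodup → l.IsChain B → l.length ≤ X.length) {ℓ : ℕ} (h2 : 2 ≤ ℓ)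
    (hℓ : ℓ ≤ X.length + 1) (hV : X.length + ℓ / 2 ≤ Fintype.card V) :
    ∃ l : List V, l.Nodup ∧ l.IsChain R ∧ l.length = ℓ := by
  classical
  have hhead : ∀ y ∉ X, ∀ x ∈ X.head?, R x y := by
    intro y hy x hx
    by_contra hc
    have := hmax (y :: X) (List.nodup_cons.2 ⟨hy, hX⟩) (List.isChain_cons.2 ⟨?_, hXB⟩)
    · simp at this
    · intro z hz
      obtain rfl : x = z := Option.mem_unique hx hz
      exact hB _ _ ((hRB _ _).resolve_left hc)
  have hlast : ∀ y ∉ X, ∀ x ∈ X.getLast?, R y x := by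
    intro y hy x hx
    by_contra hc
    have := hmax (X ++ [y]) (by simpa [List.nodup_append', hX] using hy)
      (List.isChain_append.2 ⟨hXB, by simp, ?_⟩)
    · simp at this
    · intro z hz w hw
      obtain rfl : x = z := Option.mem_unique hx hz
      obtain rfl : y = w := by simpa using hw
      exact hB _ _ ((hRB _ _).resolve_left hc)
  have hpair : ∀ A u v C, X = A ++ u :: v :: C → ∀ y ∉ X, R y u ∨ R y v := by
    intro A u v C hA y hy
    by_contra! hc
    have hyu := (hRB _ _).resolve_left hc.1
    have hyv := (hRB _ _).resolve_left hc.2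
    have := hmax (A ++ u :: y :: v :: C) ?_ ?_
    · simp [hA] at this
    · have hp : (A ++ u :: y :: v :: C).Perm (y :: X) := by
        rw [hA]
        exact (((List.Perm.swap y u _).append_left A)).trans List.perm_middle
      exact hp.nodup_iff.2 (List.nodup_cons.2 ⟨hy, hX⟩)
    · rw [hA] at hXB
      simp only [List.isChain_append, List.isChain_cons_cons, List.head?_cons] at hXB ⊢
      exact ⟨hXB.1, ⟨hB _ _ hyu, hyv, hXB.2.1.2⟩, hXB.2.2⟩
  obtain rfl | ⟨x, rfl⟩ | ⟨x, I, z, rfl⟩ :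
      X = [] ∨ (∃ x, X = [x]) ∨ ∃ x I z, X = x :: (I ++ [z]) := by
    match X with
    | [] => simp
    | [x] => simp
    | x :: x' :: X' =>
      obtain ⟨I, z, hI⟩ := (List.eq_nil_or_concat' (x' :: X')).resolve_left (by simp)
      exact .inr (.inr ⟨x, I, z, by rw [hI]⟩)
  · simp at hℓ; omega
  · obtain rfl : ℓ = 2 := by simp at hℓ; omega
    obtain ⟨y, hy, -⟩ := exists_notMem_list_finset [x] ∅ (by simp at hV ⊢; omega)
    exact ⟨[x, y], by simpa [eq_comm] using hy, by simpa using hhead y hy, rfl⟩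
  · simp only [List.length_cons, List.length_append, List.length_nil] at hℓ hV
    have hxz : x ≠ z := by rintro rfl; simp at hX
    have hxI : x ∉ I := by simp at hX; tauto
    have hzI : z ∉ I := by simp [List.nodup_append'] at hX; tauto
    have hInd : I.Nodup := by simp [List.nodup_append'] at hX; tauto
    by_cases hr : ℓ / 2 < 2
    · obtain ⟨y, hy, -⟩ := exists_notMem_list_finset (x :: (I ++ [z])) ∅ (by simp; omega)
      have h₁ := hhead y hy x (by simp)
      have h₂ := hlast y hy z (by rw [List.getLast?_cons]; simp)
      have hyx : y ≠ x := by rintro rfl; simp at hy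
      have hyz : y ≠ z := by rintro rfl; simp at hy
      rcases (by omega : ℓ = 2 ∨ ℓ = 3) with rfl | rfl
      · exact ⟨[x, y], by simp [hyx.symm], by simp [h₁], rfl⟩
      · exact ⟨[x, y, z], by simp [hyx.symm, hyz, hxz], by simp [h₁, h₂], rfl⟩
    · have hpI : ∀ A u v C, I = A ++ u :: v :: C → ∀ y ∉ x :: (I ++ [z]), R y u ∨ R y v :=
        fun A u v C hA => hpair (x :: A) u v (C ++ [z]) (by simp [hA])
      have hIX : ∀ v ∈ I, v ∈ x :: (I ++ [z]) := by simp +contextual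
      obtain ⟨l₁, l₂, T, U, h⟩ := exists_pathPair hR hInd hIX hpI (r := ℓ / 2) (by omega)
        (by omega) (by simp; omega)
      have e₁ := h.ends l₁ (by simp)
      have e₂ := h.ends l₂ (by simp)
      have hU := h.cardU
      have hlen := h.length
      have hxl := h.notMem_of_mem (v := x) (by simp) fun hx => hxI (h.subU x hx)
      have hzl := h.notMem_of_mem (v := z) (by simp) fun hz => hzI (h.subU z hz)
      have hc := h.isChain_join hR (x := x) (fun a ha => hhead a (e₁.1 a ha) x (by simp))
        (fun a ha => hhead a (e₂.1 a ha) x (by simp))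
      have hn := h.nodup_join hxl
      obtain ⟨a, l, rfl⟩ := List.exists_cons_of_ne_nil h.ne₂
      obtain ⟨l', b, hb⟩ := (List.eq_nil_or_concat' l₁).resolve_left h.ne₁
      have hc' : (l₁.reverse ++ x :: a :: l ++ [z]).IsChain R := by
        refine List.isChain_append.2 ⟨hc, by simp, ?_⟩
        intro w hw v hv
        obtain rfl : z = v := by simpa using hv
        exact hlast w (e₂.2 w (by simpa using hw)) z (by rw [List.getLast?_cons]; simp)
      have hn' : (l₁.reverse ++ x :: a :: l ++ [z]).Nodup := by
        rw [List.nodup_append']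
        refine ⟨hn, by simp, ?_⟩
        simp only [List.disjoint_singleton, List.mem_append, List.mem_reverse, List.mem_cons,
          not_or] at hzl ⊢
        exact ⟨hzl.1, hxz.symm, hzl.2⟩
      rcases Nat.even_or_odd' ℓ with ⟨r, rfl | rfl⟩
      · refine ⟨_, hn', hc', ?_⟩
        simp at hlen ⊢
        omega
      · obtain ⟨A, u, v, C, hA, hu, hv⟩ :=
          exists_free_consecutive U.card I U hInd rfl (by omega)
        obtain ⟨w, hw, hwU, hbw⟩ : ∃ w ∈ I, w ∉ U ∧ R b w := by
          rcases hpI A u v C hA b (e₁.2 b (by simp [hb])) with h | h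
          · exact ⟨u, by simp [hA], hu, h⟩
          · exact ⟨v, by simp [hA], hv, h⟩
        have hwl := h.notMem_of_mem (hIX w hw) hwU
        refine ⟨w :: (l₁.reverse ++ x :: a :: l ++ [z]), List.nodup_cons.2 ⟨?_, hn'⟩,
          List.isChain_cons.2 ⟨?_, hc'⟩, ?_⟩
        · have : w ≠ x := by rintro rfl; exact hxI hw
          have : w ≠ z := by rintro rfl; exact hzI hw
          simp only [List.mem_append, List.mem_reverse, List.mem_cons, List.not_mem_nil] at hwl ⊢
          tauto
        · simpa [hb] using hR _ _ hbw
        · simp at hlen ⊢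
          omega

theorem exists_longest_path {V : Type*} [Fintype V] (B : V → V → Prop) :
    ∃ X : List V, X.Nodup ∧ X.IsChain B ∧
      ∀ l : List V, l.Nodup → l.IsChain B → l.length ≤ X.length := by
  classical
  let S : Set ℕ := {k | ∃ l : List V, l.Nodup ∧ l.IsChain B ∧ l.length = k}
  have hne : S.Nonempty := ⟨0, [], by simp⟩
  have hbdd : BddAbove S := ⟨Fintype.card V, by
    rintro _ ⟨l, hl, -, rfl⟩
    exact hl.length_le_card⟩
  obtain ⟨X, hX, hXB, hlen⟩ := Nat.sSup_mem hne hbdd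
  exact ⟨X, hX, hXB, fun l hl hlB => hlen ▸ le_csSup hbdd ⟨l, hl, hlB, rfl⟩⟩

theorem AvoidsPath.of_list {n t ℓ : ℕ} {c : Sym2 (Fin n) → Fin t} {i : Fin t}
    {l : List (Fin n)} (hl : l.Nodup) (hc : l.IsChain fun u v => c s(u, v) ≠ i)
    (hlen : ℓ ≤ l.length) : AvoidsPath n t ℓ c i := by
  refine ⟨fun k => l[k.1]'(by omega), fun a b hab => ?_, fun k h => ?_⟩
  · exact Fin.ext ((hl.getElem_inj_iff).1 hab)
  · exact List.isChain_iff_getElem.1 hc k (by omega)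

theorem isChromRamsey_two {ℓ₁ ℓ₂ : ℕ} (h1 : 2 ≤ ℓ₁) (h12 : ℓ₁ ≤ ℓ₂) :
    IsChromRamsey 2 ![ℓ₁, ℓ₂] (ℓ₂ + ℓ₁ / 2 - 1) := by
  intro c
  have hsymm (i : Fin 2) (u v) (h : c s(u, v) ≠ i) : c s(v, u) ≠ i := by rwa [Sym2.eq_swap]
  have hcov (u v) : c s(u, v) ≠ 0 ∨ c s(u, v) ≠ 1 := by
    by_cases h : c s(u, v) = 0 <;> simp [h]
  obtain ⟨X, hX, hXc, hXmax⟩ := exists_longest_path fun u v => c s(u, v) ≠ 0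
  obtain ⟨Y, hY, hYc, hYmax⟩ := exists_longest_path fun u v => c s(u, v) ≠ 1
  by_cases hX' : ℓ₁ ≤ X.length
  · exact ⟨0, .of_list hX hXc hX'⟩
  by_cases hY' : ℓ₂ ≤ Y.length
  · exact ⟨1, .of_list hY hYc hY'⟩
  exfalso
  have hX1 : 1 ≤ X.length := by
    simpa using hXmax [⟨0, by omega⟩] (by simp) (by simp)
  have hY1 : 1 ≤ Y.length := by
    simpa using hYmax [⟨0, by omega⟩] (by simp) (by simp)
  rcases le_or_gt X.length Y.length with hXY | hXY
  · obtain ⟨l, hl, hlc, hlen⟩ := exists_path_of_longest (hsymm 0) (hsymm 1) hcov hY hYc hYmax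
      (ℓ := min ℓ₁ (Y.length + 1)) (by omega) (by omega) (by rw [Fintype.card_fin]; omega)
    have := hXmax l hl hlc
    omega
  · obtain ⟨l, hl, hlc, hlen⟩ := exists_path_of_longest (hsymm 1) (hsymm 0)
      (fun u v => (hcov u v).symm) hX hXc hXmax
      (ℓ := X.length + 1) (by omega) le_rfl (by rw [Fintype.card_fin]; omega)
    have := hYmax l hl hlc
    omega

theorem le_of_isChromRamsey_two {ℓ₁ ℓ₂ n : ℕ} (h1 : 2 ≤ ℓ₁) (h2 : 2 ≤ ℓ₂)
    (h : IsChromRamsey 2 ![ℓ₁, ℓ₂] n) : ℓ₂ + ℓ₁ / 2 - 1 ≤ n := by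
  classical
  by_contra! hn
  obtain ⟨i, P, hP, hPc⟩ := h fun e => if ∀ v ∈ e, v.1 < ℓ₂ - 1 then 0 else 1
  fin_cases i
  · change Fin ℓ₁ → Fin n at P
    have key (j : Fin (ℓ₁ / 2)) : ∃ k : Fin ℓ₁, k.1 / 2 = j ∧ ℓ₂ - 1 ≤ (P k).1 := by
      have hj : 2 * j.1 + 1 < ℓ₁ := by omega
      have := hPc (2 * j) hj
      by_contra! hc
      have ha := hc ⟨2 * j, by omega⟩ (by simp)
      have hb := hc ⟨2 * j + 1, hj⟩ (by simp; omega)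
      simp [ha, hb] at this
    choose f hf hfP using key
    have hcard := Fintype.card_le_of_injective
      (fun j => (⟨(P (f j)).1 - (ℓ₂ - 1), by have := (P (f j)).2; have := hfP j; omega⟩ :
        Fin (n - (ℓ₂ - 1)))) (fun a b hab => ?_)
    · simp only [Fintype.card_fin] at hcard
      omega
    · have ha := hfP a
      have hb := hfP b
      simp only [Fin.mk.injEq] at hab
      have : f a = f b := hP (Fin.ext (by omega))
      exact Fin.ext (by rw [← hf a, ← hf b, this])
  · change Fin ℓ₂ → Fin n at P
    have key (k : Fin ℓ₂) : (P k).1 < ℓ₂ - 1 := by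
      have hedge (j : ℕ) (hj : j + 1 < ℓ₂) :
          (P ⟨j, by omega⟩).1 < ℓ₂ - 1 ∧ (P ⟨j + 1, hj⟩).1 < ℓ₂ - 1 := by
        have := hPc j hj
        simp only [Sym2.mem_iff, forall_eq_or_imp, forall_eq] at this
        by_contra hc
        exact this (if_neg hc)
      obtain ⟨k, hk⟩ := k
      by_cases hk' : k + 1 < ℓ₂
      · exact (hedge k hk').1
      · obtain ⟨j, rfl⟩ : ∃ j, k = j + 1 := ⟨k - 1, by omega⟩
        exact (hedge j hk).2
    have hcard := Fintype.card_le_of_injective (fun k => (⟨(P k).1, key k⟩ : Fin (ℓ₂ - 1)))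
      (fun a b hab => hP (Fin.ext (by simpa using hab)))
    simp only [Fintype.card_fin] at hcard
    omega

/-- Theorem 2 (Gerencsér–Gyárfás, asymmetric 2-colour case):
`p(ℓ₁, ℓ₂) = ℓ₂ + ⌊ℓ₁/2⌋ - 1`, i.e. this is the least `n` such that every `2`-colouring of
`K_n` contains either a path on `ℓ₁` vertices avoiding colour 1 or a path on `ℓ₂` vertices
avoiding colour 2. -/
theorem two_colour_path_ramsey (ℓ₁ ℓ₂ : ℕ) (h1 : 2 ≤ ℓ₁) (h12 : ℓ₁ ≤ ℓ₂) :
    pRamsey 2 ![ℓ₁, ℓ₂] = ℓ₂ + ℓ₁ / 2 - 1 ∧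
    IsLeast {n | IsChromRamsey 2 ![ℓ₁, ℓ₂] n} (ℓ₂ + ℓ₁ / 2 - 1) := by
  have h : IsLeast {n | IsChromRamsey 2 ![ℓ₁, ℓ₂] n} (ℓ₂ + ℓ₁ / 2 - 1) :=
    ⟨isChromRamsey_two h1 h12, fun _ hn => le_of_isChromRamsey_two h1 (h1.trans h12) hn⟩
  exact ⟨h.csInf_eq, h⟩
end
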